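/- Equivariant Littlewood–Richardson rule (Molev–Kreiman): the factorial Schur structure constant satisfies c_{λ,μ}^ν = Σ_{L ∈ LR_{λ,μ}^ν} c_L, where the sum is over equivariant Littlewood–Richardson skew tableaux L of shape λ*μ with unbarred content ν, and c_L = ∏_{barred a ∈ L} (y_{|a|' + ω(L^u_{<a})_{|a|}} - y_{|a|' + c(a) - r(a)}). -/

import Mathlib

open scoped Classical
open MvPolynomial

noncomputable section

namespace EqLR

/-- Ambient polynomial ring `ℂ[x_1,…,x_d ; y_i (i ∈ ℤ)]`.
The variables `x_j` are indexed by `Fin d` (so `x_{j+1} = X (Sum.inl j)`), and the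
variables `y_i` are indexed by `ℤ` (only positive indices actually occur). -/
abbrev P (d : ℕ) := MvPolynomial (Fin d ⊕ ℤ) ℂ

/-- The variable `y_i`. -/
def yI (d : ℕ) (i : ℤ) : P d := X (Sum.inr i)

/-- The variable `x_v` for a value `v ∈ {1,…,d}` (junk value `0` otherwise). -/
def xv (d : ℕ) (v : ℕ) : P d :=
  if h : v - 1 < d then X (Sum.inl ⟨v - 1, h⟩) else 0

/-- The component `ξ_v` of a vector `ξ ∈ ℕ^d`, for a (1-based) value `v ∈ {1,…,d}`. -/
def vecAt {d : ℕ} (ξ : Fin d → ℕ) (v : ℕ) : ℕ :=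
  if h : v - 1 < d then ξ ⟨v - 1, h⟩ else 0

/-- `μ ∈ ℕ^d` is a partition:  `μ_1 ≥ μ_2 ≥ … ≥ μ_d`. -/
def IsPartitionVec {d : ℕ} (μ : Fin d → ℕ) : Prop :=
  ∀ i j : Fin d, i ≤ j → μ j ≤ μ i

/-- `|μ| = μ_1 + ⋯ + μ_d`. -/
def wt {d : ℕ} (μ : Fin d → ℕ) : ℕ := ∑ i, μ i

/-- `ρ = (d-1, d-2, …, 0)`. -/
def rho (d : ℕ) : Fin d → ℕ := fun i => d - 1 - (i : ℕ)

/-- Cells `(r, c)` (both 0-based) of the Young/reverse Young diagram whose row `r` has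
length `μ_{r+1}`.  For the reverse diagram, rows are numbered bottom-to-top and columns
right-to-left; for the ordinary Young diagram, top-to-bottom and left-to-right. -/
def cells (d : ℕ) (μ : Fin d → ℕ) : Finset (ℕ × ℕ) :=
  (Finset.range d ×ˢ Finset.range (Finset.univ.sup μ + 1)).filter
    fun rc => ∃ h : rc.1 < d, rc.2 < μ ⟨rc.1, h⟩

/-- In the column reading word of a *reverse* diagram (columns right-to-left, i.e. in
increasing 0-based column index, each column read top-to-bottom, i.e. in decreasing
0-based row index), the cell `b` is read strictly before the cell `a`. -/
def revBefore (a b : ℕ × ℕ) : Prop := b.2 < a.2 ∨ (b.2 = a.2 ∧ a.1 < b.1)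

/-- In the column reading word of an ordinary Young diagram (rightmost column first,
each column read top-to-bottom), the cell `b` is read strictly before the cell `a`. -/
def youngBefore (a b : ℕ × ℕ) : Prop := a.2 < b.2 ∨ (b.2 = a.2 ∧ b.1 < a.1)

/-- A reverse tableau of shape `μ`: entries in `{1,…,d}`, weakly increasing along rows
(left to right) and strictly increasing down columns (top to bottom). -/
structure RevTableau (d : ℕ) (μ : Fin d → ℕ) where
  val : ℕ × ℕ → ℕ
  mem : ∀ a ∈ cells d μ, 1 ≤ val a ∧ val a ≤ d
  zero : ∀ a ∉ cells d μ, val a = 0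
  row : ∀ r c : ℕ, (r, c + 1) ∈ cells d μ → val (r, c + 1) ≤ val (r, c)
  col : ∀ r c : ℕ, (r + 1, c) ∈ cells d μ → val (r + 1, c) < val (r, c)

/-- The factor `x_v - y_{(d+1-v) + c(a) - r(a)}` attached to an entry of value `v` in
the cell `a` of the reverse diagram (`c(a) = a.2 + 1`, `r(a) = a.1 + 1`, 1-based). -/
def factor (d : ℕ) (v : ℕ) (a : ℕ × ℕ) : P d :=
  xv d v - yI d ((d : ℤ) + 1 - (v : ℤ) + (a.2 : ℤ) - (a.1 : ℤ))

/-- The factorial Schur function `s_μ(x|y) = Σ_R (x|y)^R`. -/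
def fSchur (d : ℕ) (μ : Fin d → ℕ) : P d :=
  ∑ᶠ R : RevTableau d μ, ∏ a ∈ cells d μ, factor d (R.val a) a

/-- The ordinary Schur function `s_μ(x) = Σ_R x^R`. -/
def schurX (d : ℕ) (μ : Fin d → ℕ) : P d :=
  ∑ᶠ R : RevTableau d μ, ∏ a ∈ cells d μ, xv d (R.val a)

/-- The subalgebra `ℂ[y]` of polynomials in the `y` variables only. -/
def ySub (d : ℕ) : Subalgebra ℂ (P d) :=
  Algebra.adjoin ℂ (Set.range fun i : ℤ => yI d i)

/-- `p` is symmetric in the `x` variables. -/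
def SymmX {d : ℕ} (p : P d) : Prop :=
  ∀ σ : Equiv.Perm (Fin d), rename (⇑(Equiv.sumCongr σ (Equiv.refl ℤ))) p = p

/-- The falling factorial power `(x_j | y)^k = (x_j - y_1)⋯(x_j - y_k)`. -/
def ffPow (d : ℕ) (j : Fin d) (k : ℕ) : P d :=
  ∏ i ∈ Finset.range k, (X (Sum.inl j) - yI d ((i : ℤ) + 1))

/-- `(x|y)^ξ = (x_1|y)^{ξ_1} ⋯ (x_d|y)^{ξ_d}`. -/
def xyPow (d : ℕ) (ξ : Fin d → ℕ) : P d := ∏ j : Fin d, ffPow d j (ξ j)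

/-- The alternant `a_ξ(x|y) = det[(x_j|y)^{ξ_i}]`. -/
def aDet (d : ℕ) (ξ : Fin d → ℕ) : P d :=
  Matrix.det (Matrix.of fun i j : Fin d => ffPow d j (ξ i))

/-! ### Skew barred tableaux of shape `λ*μ` -/

/-- A skew barred tableau of shape `λ*μ`: the Young diagram `λ` (placed above and to
the right of the reverse diagram `μ`) is filled with values in `{1,…,d}` (field `top`),
the reverse diagram `μ` is filled with values in `{1,…,d}` (field `bot`), some of whose
cells may be barred (field `barred`); values weakly increase along rows left-to-right
and strictly increase down columns, ignoring bars. -/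
structure SkewBarredTableau (d : ℕ) (lam mu : Fin d → ℕ) where
  top : ℕ × ℕ → ℕ
  bot : ℕ × ℕ → ℕ
  barred : ℕ × ℕ → Prop
  top_mem : ∀ a ∈ cells d lam, 1 ≤ top a ∧ top a ≤ d
  top_zero : ∀ a ∉ cells d lam, top a = 0
  bot_mem : ∀ a ∈ cells d mu, 1 ≤ bot a ∧ bot a ≤ d
  bot_zero : ∀ a ∉ cells d mu, bot a = 0
  barred_sub : ∀ a, barred a → a ∈ cells d mu
  top_row : ∀ r c : ℕ, (r, c + 1) ∈ cells d lam → top (r, c) ≤ top (r, c + 1)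
  top_col : ∀ r c : ℕ, (r + 1, c) ∈ cells d lam → top (r, c) < top (r + 1, c)
  bot_row : ∀ r c : ℕ, (r, c + 1) ∈ cells d mu → bot (r, c + 1) ≤ bot (r, c)
  bot_col : ∀ r c : ℕ, (r + 1, c) ∈ cells d mu → bot (r + 1, c) < bot (r, c)

namespace SkewBarredTableau

variable {d : ℕ} {lam mu : Fin d → ℕ}

/-- `ω(L^u_{<a})_k`: the number of `k`'s among the unbarred entries of `L` read strictly
before the `μ`-cell `a` in the unbarred column word (all of `λ` is read before `μ`). -/
def countBefore (L : SkewBarredTableau d lam mu) (a : ℕ × ℕ) (k : ℕ) : ℕ :=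
  ((cells d lam).filter fun b => L.top b = k).card +
  ((cells d mu).filter fun b => ¬ L.barred b ∧ L.bot b = k ∧ revBefore a b).card

/-- `ω(L^u_{≤a})_k`: as `countBefore`, but the entry of `a` itself is also counted when
`a` is unbarred. -/
def countUpTo (L : SkewBarredTableau d lam mu) (a : ℕ × ℕ) (k : ℕ) : ℕ :=
  ((cells d lam).filter fun b => L.top b = k).card +
  ((cells d mu).filter fun b => ¬ L.barred b ∧ L.bot b = k ∧ (revBefore a b ∨ b = a)).card

/-- Prefix content within the `λ`-part of the word. -/
def topCountUpTo (L : SkewBarredTableau d lam mu) (a : ℕ × ℕ) (k : ℕ) : ℕ :=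
  ((cells d lam).filter fun b => L.top b = k ∧ (youngBefore a b ∨ b = a)).card

/-- `ω(L^u)_k`: total content of the unbarred column word of `L`. -/
def content (L : SkewBarredTableau d lam mu) (k : ℕ) : ℕ :=
  ((cells d lam).filter fun b => L.top b = k).card +
  ((cells d mu).filter fun b => ¬ L.barred b ∧ L.bot b = k).card

/-- The unbarred column word of `L` is Yamanouchi: every prefix contains at least as
many `k`'s as `(k+1)`'s, for every `k ≥ 1`. -/
def Yamanouchi (L : SkewBarredTableau d lam mu) : Prop :=
  (∀ a ∈ cells d lam, ∀ k : ℕ, 1 ≤ k → L.topCountUpTo a (k + 1) ≤ L.topCountUpTo a k) ∧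
  (∀ a ∈ cells d mu, ¬ L.barred a → ∀ k : ℕ, 1 ≤ k →
      L.countUpTo a (k + 1) ≤ L.countUpTo a k)

/-- `L` is an equivariant Littlewood–Richardson skew tableau of shape `λ*μ` and unbarred
content `ν`. -/
def IsLR (L : SkewBarredTableau d lam mu) (ν : Fin d → ℕ) : Prop :=
  L.Yamanouchi ∧ ∀ i : Fin d, L.content ((i : ℕ) + 1) = ν i

/-- The index `|a|' + ω(L^u_{<a})_{|a|}` of the first `y` in the factor of `c_L` at a
barred cell `a`. -/
def eIdx (L : SkewBarredTableau d lam mu) (a : ℕ × ℕ) : ℤ :=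
  ((d : ℤ) + 1 - (L.bot a : ℤ)) + (L.countBefore a (L.bot a) : ℤ)

/-- The index `|a|' + c(a) - r(a)` of the second `y` in the factor of `c_L` at a barred
cell `a`. -/
def fIdx (L : SkewBarredTableau d lam mu) (a : ℕ × ℕ) : ℤ :=
  ((d : ℤ) + 1 - (L.bot a : ℤ)) + (a.2 : ℤ) - (a.1 : ℤ)

/-- The weight `c_L = ∏_{a barred} (y_{|a|'+ω(L^u_{<a})_{|a|}} - y_{|a|'+c(a)-r(a)})`. -/
def cWt (L : SkewBarredTableau d lam mu) : P d :=
  ∏ a ∈ (cells d mu).filter (fun a => L.barred a), (yI d (L.eIdx a) - yI d (L.fIdx a))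

/-- `Δ(a) = ω(L^u_{≤a})_{|a|} - c(a) + r(a)`. -/
def Δ (L : SkewBarredTableau d lam mu) (a : ℕ × ℕ) : ℤ :=
  (L.countUpTo a (L.bot a) : ℤ) - ((a.2 : ℤ) + 1) + ((a.1 : ℤ) + 1)

end SkewBarredTableau

/-! ### Reverse barred tableaux -/

/-- A reverse barred tableau of shape `μ`. -/
structure RevBarredTableau (d : ℕ) (μ : Fin d → ℕ) where
  val : ℕ × ℕ → ℕ
  barred : ℕ × ℕ → Prop
  mem : ∀ a ∈ cells d μ, 1 ≤ val a ∧ val a ≤ d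
  zero : ∀ a ∉ cells d μ, val a = 0
  barred_sub : ∀ a, barred a → a ∈ cells d μ
  row : ∀ r c : ℕ, (r, c + 1) ∈ cells d μ → val (r, c + 1) ≤ val (r, c)
  col : ∀ r c : ℕ, (r + 1, c) ∈ cells d μ → val (r + 1, c) < val (r, c)

namespace RevBarredTableau

variable {d : ℕ} {μ : Fin d → ℕ}

/-- `ω(B^u_{<a})_k`. -/
def countBefore (B : RevBarredTableau d μ) (a : ℕ × ℕ) (k : ℕ) : ℕ :=
  ((cells d μ).filter fun b => ¬ B.barred b ∧ B.val b = k ∧ revBefore a b).card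

/-- `ω(B^u_{≤a})_k` (including `a` itself when unbarred). -/
def countUpTo (B : RevBarredTableau d μ) (a : ℕ × ℕ) (k : ℕ) : ℕ :=
  ((cells d μ).filter fun b => ¬ B.barred b ∧ B.val b = k ∧ (revBefore a b ∨ b = a)).card

/-- `ω(B^u)_k`. -/
def content (B : RevBarredTableau d μ) (k : ℕ) : ℕ :=
  ((cells d μ).filter fun b => ¬ B.barred b ∧ B.val b = k).card

/-- `e_{ξ,B}(a) = (ξ + ω(B^u_{<a}))_{|a|}`. -/
def eIdx (B : RevBarredTableau d μ) (ξ : Fin d → ℕ) (a : ℕ × ℕ) : ℤ :=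
  (vecAt ξ (B.val a) : ℤ) + (B.countBefore a (B.val a) : ℤ)

/-- `f_B(a) = |a|' + c(a) - r(a)`. -/
def fIdx (B : RevBarredTableau d μ) (a : ℕ × ℕ) : ℤ :=
  ((d : ℤ) + 1 - (B.val a : ℤ)) + (a.2 : ℤ) - (a.1 : ℤ)

/-- `c_{ξ,B} = ∏_{a barred} (y_{e_{ξ,B}(a)} - y_{f_B(a)})`. -/
def cXi (B : RevBarredTableau d μ) (ξ : Fin d → ℕ) : P d :=
  ∏ a ∈ (cells d μ).filter (fun a => B.barred a), (yI d (B.eIdx ξ a) - yI d (B.fIdx a))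

/-- The unbarred column word of `λ*B` is Yamanouchi (the `λ`-part is the canonical
filling of `λ`, whose whole content `λ` is added to every prefix of `B^u`). -/
def StarYam (B : RevBarredTableau d μ) (lam : Fin d → ℕ) : Prop :=
  ∀ a ∈ cells d μ, ¬ B.barred a → ∀ k : ℕ, 1 ≤ k →
    vecAt lam (k + 1) + B.countUpTo a (k + 1) ≤ vecAt lam k + B.countUpTo a k

end RevBarredTableau

/-! ### Reverse hatted tableaux -/

/-- A hat decoration: none, left hat, or right hat. -/
inductive Hat where
  | unhatted : Hat
  | left : Hat
  | right : Hat
deriving DecidableEq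

/-- A reverse hatted tableau of shape `μ`. -/
structure RevHattedTableau (d : ℕ) (μ : Fin d → ℕ) where
  val : ℕ × ℕ → ℕ
  hat : ℕ × ℕ → Hat
  mem : ∀ a ∈ cells d μ, 1 ≤ val a ∧ val a ≤ d
  zero : ∀ a ∉ cells d μ, val a = 0
  hat_out : ∀ a ∉ cells d μ, hat a = Hat.unhatted
  row : ∀ r c : ℕ, (r, c + 1) ∈ cells d μ → val (r, c + 1) ≤ val (r, c)
  col : ∀ r c : ℕ, (r + 1, c) ∈ cells d μ → val (r + 1, c) < val (r, c)

namespace RevHattedTableau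

variable {d : ℕ} {μ : Fin d → ℕ}

/-- `ω(H^u_{<a})_k`: content of the unhatted column word of `H` read before `a`. -/
def countBefore (H : RevHattedTableau d μ) (a : ℕ × ℕ) (k : ℕ) : ℕ :=
  ((cells d μ).filter fun b => H.hat b = Hat.unhatted ∧ H.val b = k ∧ revBefore a b).card

/-- `ω(H^u)_k`. -/
def content (H : RevHattedTableau d μ) (k : ℕ) : ℕ :=
  ((cells d μ).filter fun b => H.hat b = Hat.unhatted ∧ H.val b = k).card

/-- `e_{ξ,H}(a) = (ξ + ω(H^u_{<a}))_{|a|}`. -/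
def eIdx (H : RevHattedTableau d μ) (ξ : Fin d → ℕ) (a : ℕ × ℕ) : ℤ :=
  (vecAt ξ (H.val a) : ℤ) + (H.countBefore a (H.val a) : ℤ)

/-- `f_H(a) = |a|' + c(a) - r(a)`. -/
def fIdx (H : RevHattedTableau d μ) (a : ℕ × ℕ) : ℤ :=
  ((d : ℤ) + 1 - (H.val a : ℤ)) + (a.2 : ℤ) - (a.1 : ℤ)

/-- `d_{ξ,H} = ∏_{a ∈ H^l} y_{e_{ξ,H}(a)} · ∏_{a ∈ H^r} (-y_{f_H(a)})`. -/
def dWt (H : RevHattedTableau d μ) (ξ : Fin d → ℕ) : P d :=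
  (∏ a ∈ (cells d μ).filter (fun a => H.hat a = Hat.left), yI d (H.eIdx ξ a)) *
  ∏ a ∈ (cells d μ).filter (fun a => H.hat a = Hat.right), (-(yI d (H.fIdx a)))

end RevHattedTableau

/-- `H̄ = B`: `H` unbars to the reverse barred tableau `B`. -/
def UnbarsTo {d : ℕ} {μ : Fin d → ℕ} (H : RevHattedTableau d μ)
    (B : RevBarredTableau d μ) : Prop :=
  H.val = B.val ∧ ∀ a, (H.hat a ≠ Hat.unhatted ↔ B.barred a)

/-- The simple transposition `σ_i` on values: exchanges `i` and `i+1`. -/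
def swapVal (i v : ℕ) : ℕ := if v = i then i + 1 else if v = i + 1 then i else v

/-- The action of `σ_i` on `ℕ^d` by permuting coordinates. -/
def swapVec {d : ℕ} (i : ℕ) (ξ : Fin d → ℕ) : Fin d → ℕ :=
  fun j => vecAt ξ (swapVal i ((j : ℕ) + 1))

/-! ### Reverse (barred) subtableaux -/

/-- A reverse subtableau of shape `μ`: each cell is empty (value `0`) or carries a value
in `{1,…,d}`; no row or column conditions. -/
structure RevSubTableau (d : ℕ) (μ : Fin d → ℕ) where
  val : ℕ × ℕ → ℕ
  mem : ∀ a ∈ cells d μ, val a ≤ d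
  zero : ∀ a ∉ cells d μ, val a = 0

/-- A reverse barred subtableau of shape `μ`: a reverse subtableau some of whose filled
cells are barred. -/
structure RevBarredSubTableau (d : ℕ) (μ : Fin d → ℕ) where
  val : ℕ × ℕ → ℕ
  barred : ℕ × ℕ → Prop
  mem : ∀ a ∈ cells d μ, val a ≤ d
  zero : ∀ a ∉ cells d μ, val a = 0
  barred_filled : ∀ a, barred a → a ∈ cells d μ ∧ val a ≠ 0

/-- `(x|y)^R` for a reverse subtableau `R`. -/
def RevSubTableau.xyProd {d : ℕ} {μ : Fin d → ℕ} (R : RevSubTableau d μ) : P d :=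
  ∏ a ∈ (cells d μ).filter (fun a => R.val a ≠ 0), factor d (R.val a) a

namespace RevBarredSubTableau

variable {d : ℕ} {μ : Fin d → ℕ}

/-- `ω(B^u_{<a})_k`: unbarred filled entries of value `k` read before `a`. -/
def countBefore (B : RevBarredSubTableau d μ) (a : ℕ × ℕ) (k : ℕ) : ℕ :=
  ((cells d μ).filter fun b => ¬ B.barred b ∧ B.val b = k ∧ revBefore a b).card

/-- `ω(B^u)_k`. -/
def content (B : RevBarredSubTableau d μ) (k : ℕ) : ℕ :=
  ((cells d μ).filter fun b => ¬ B.barred b ∧ B.val b = k).card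

/-- `e_{ξ,B}(a) = (ξ + ω(B^u_{<a}))_{|a|}`. -/
def eIdx (B : RevBarredSubTableau d μ) (ξ : Fin d → ℕ) (a : ℕ × ℕ) : ℤ :=
  (vecAt ξ (B.val a) : ℤ) + (B.countBefore a (B.val a) : ℤ)

/-- `f_B(a) = |a|' + c(a) - r(a)`. -/
def fIdx (B : RevBarredSubTableau d μ) (a : ℕ × ℕ) : ℤ :=
  ((d : ℤ) + 1 - (B.val a : ℤ)) + (a.2 : ℤ) - (a.1 : ℤ)

/-- `c_{ξ,B}`. -/
def cXi (B : RevBarredSubTableau d μ) (ξ : Fin d → ℕ) : P d :=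
  ∏ a ∈ (cells d μ).filter (fun a => B.barred a), (yI d (B.eIdx ξ a) - yI d (B.fIdx a))

end RevBarredSubTableau

end EqLR

namespace EqLR

/-! ### Permutations of the `x` variables and alternating sums -/

/-- The action of a permutation on the `x` variables of a polynomial. -/
def permX {d : ℕ} (σ : Equiv.Perm (Fin d)) : P d →ₐ[ℂ] P d := rename (Sum.map σ id)

lemma permX_mul {d : ℕ} (σ τ : Equiv.Perm (Fin d)) (p : P d) :
    permX (σ * τ) p = permX σ (permX τ p) := by
  simp only [permX, rename_rename]
  congr 1
  congr 1
  funext z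
  cases z <;> simp

lemma permX_one {d : ℕ} (p : P d) : permX 1 p = p := by
  have h : (Sum.map (1 : Equiv.Perm (Fin d)) id : Fin d ⊕ ℤ → Fin d ⊕ ℤ) = id := by
    funext z; cases z <;> simp
  simp only [permX]
  rw [h, rename_id_apply]

@[simp] lemma permX_yI {d : ℕ} (σ : Equiv.Perm (Fin d)) (i : ℤ) : permX σ (yI d i) = yI d i := by
  simp [permX, yI]

@[simp] lemma permX_X {d : ℕ} (σ : Equiv.Perm (Fin d)) (j : Fin d) :
    permX σ (X (Sum.inl j) : P d) = X (Sum.inl (σ j)) := by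
  simp [permX]

@[simp] lemma permX_ffPow {d : ℕ} (σ : Equiv.Perm (Fin d)) (j : Fin d) (k : ℕ) :
    permX σ (ffPow d j k) = ffPow d (σ j) k := by
  simp [ffPow, map_prod]

/-- The alternating sum of a polynomial over all permutations of the `x` variables. -/
def alt {d : ℕ} : P d →ₗ[ℂ] P d :=
  ∑ σ : Equiv.Perm (Fin d), ((Equiv.Perm.sign σ : ℤ) : ℂ) • (permX σ).toLinearMap

lemma alt_apply {d : ℕ} (p : P d) :
    alt p = ∑ σ : Equiv.Perm (Fin d), ((Equiv.Perm.sign σ : ℤ) : ℂ) • permX σ p := by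
  simp [alt]

lemma alt_mul_of_symm {d : ℕ} {q : P d} (hq : ∀ σ, permX σ q = q) (p : P d) :
    alt (q * p) = q * alt p := by
  simp only [alt_apply, Finset.mul_sum, map_mul, hq, mul_smul_comm]

lemma alt_eq_zero_of_swap {d : ℕ} {i j : Fin d} (hij : i ≠ j) {p : P d}
    (hp : permX (Equiv.swap i j) p = p) : alt p = 0 := by
  rw [alt_apply]
  refine Finset.sum_involution (fun σ _ => σ * Equiv.swap i j) ?_ ?_ ?_ ?_
  · intro σ _
    rw [permX_mul, hp]
    simp [hij]
  · intro σ _ _ h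
    exact hij (Equiv.swap_eq_one_iff.1 (mul_eq_left.1 h))
  · intros; exact Finset.mem_univ _
  · intro σ _
    simp [mul_assoc]

/-- The product `(x_1|y)^{ξ(1)} ⋯ (x_d|y)^{ξ(d)}`, for exponents indexed by values `1,…,d`. -/
def ffProd (d : ℕ) (ξ : ℕ → ℕ) : P d := ∏ j : Fin d, ffPow d j (ξ (j + 1))

/-- The alternant with exponents `ξ`. -/
def alternant (d : ℕ) (ξ : ℕ → ℕ) : P d := alt (ffProd d ξ)

lemma ffProd_congr {d : ℕ} {ξ ξ' : ℕ → ℕ} (h : ∀ v, 1 ≤ v → v ≤ d → ξ v = ξ' v) :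
    ffProd d ξ = ffProd d ξ' :=
  Finset.prod_congr rfl fun j _ => by rw [h _ (by omega) (by omega)]

/-- The transposition of the `x` variables of values `p+1` and `p+2`. -/
def adjSwap {d p : ℕ} (hp : p + 1 < d) : Equiv.Perm (Fin d) :=
  Equiv.swap ⟨p, by omega⟩ ⟨p + 1, hp⟩

lemma permX_ffProd {d p : ℕ} (hp : p + 1 < d) {ξ : ℕ → ℕ} (h : ξ (p + 1) = ξ (p + 2)) :
    permX (adjSwap hp) (ffProd d ξ) = ffProd d ξ := by
  simp only [ffProd, map_prod, permX_ffPow]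
  rw [← Equiv.prod_comp (adjSwap hp) (fun j => ffPow d j (ξ (j + 1)))]
  refine Finset.prod_congr rfl fun j _ => ?_
  congr 1
  unfold adjSwap
  by_cases h1 : j = ⟨p, by omega⟩
  · subst h1; simpa using h
  · by_cases h2 : j = ⟨p + 1, hp⟩
    · subst h2; simpa using h.symm
    · rw [Equiv.swap_apply_of_ne_of_ne h1 h2]

lemma permX_of_adjSwap {d : ℕ} {q : P d} (h : ∀ p (hp : p + 1 < d), permX (adjSwap hp) q = q)
    (σ : Equiv.Perm (Fin d)) : permX σ q = q := by
  cases d with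
  | zero => rw [Subsingleton.elim σ 1, permX_one]
  | succ n =>
    have hσ : σ ∈ Submonoid.closure (Set.range fun i : Fin n => Equiv.swap i.castSucc i.succ) := by
      rw [Equiv.Perm.mclosure_swap_castSucc_succ]; trivial
    induction hσ using Submonoid.closure_induction with
    | mem x hx =>
      obtain ⟨i, rfl⟩ := hx
      exact h i (by omega)
    | one => exact permX_one q
    | mul x y _ _ hx hy => rw [permX_mul, hy, hx]

lemma xv_eq {d v : ℕ} (h1 : 1 ≤ v) (h2 : v ≤ d) : xv d v = X (Sum.inl ⟨v - 1, by omega⟩) := by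
  rw [xv, dif_pos]

lemma xv_succ {d : ℕ} (j : Fin d) : xv d (j + 1) = X (Sum.inl j) := by
  rw [xv_eq (by omega) (by omega)]
  rfl

lemma permX_xv {d p v : ℕ} (hp : p + 1 < d) (h1 : 1 ≤ v) (h2 : v ≤ d) (hv : v ≠ p + 1)
    (hv' : v ≠ p + 2) : permX (adjSwap hp) (xv d v) = xv d v := by
  rw [xv_eq h1 h2, permX_X, adjSwap, Equiv.swap_apply_of_ne_of_ne]
  · intro h; rw [Fin.mk.injEq] at h; omega
  · intro h; rw [Fin.mk.injEq] at h; omega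

lemma permX_xv_left {d p : ℕ} (hp : p + 1 < d) :
    permX (adjSwap hp) (xv d (p + 1)) = xv d (p + 2) := by
  rw [xv_eq (by omega) (by omega), xv_eq (by omega) (by omega), permX_X, adjSwap]
  congr 2
  exact Equiv.swap_apply_left _ _

lemma permX_xv_right {d p : ℕ} (hp : p + 1 < d) :
    permX (adjSwap hp) (xv d (p + 2)) = xv d (p + 1) := by
  rw [xv_eq (by omega) (by omega), xv_eq (by omega) (by omega), permX_X, adjSwap]
  congr 2
  exact Equiv.swap_apply_right _ _

/-- Multiplying `(x|y)^ξ` by one further factor for each of a set of distinct values. -/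
lemma ffProd_mul_prod {d : ℕ} (ξ : ℕ → ℕ) (T : Finset ℕ) (D : ℕ → ℕ)
    (hD : ∀ r ∈ T, 1 ≤ D r ∧ D r ≤ d) (hinj : Set.InjOn D T) :
    ffProd d ξ * ∏ r ∈ T, (xv d (D r) - yI d ((ξ (D r) : ℤ) + 1)) =
      ffProd d (fun v => ξ v + (T.filter fun r => D r = v).card) := by
  induction T using Finset.induction_on with
  | empty => simp
  | insert a T ha ih =>
    have ih' := ih (fun r hr => hD r (Finset.mem_insert_of_mem hr))
      (hinj.mono (by simp))
    rw [Finset.prod_insert ha, mul_left_comm, ih', mul_comm]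
    obtain ⟨h1, h2⟩ := hD a (Finset.mem_insert_self a T)
    let j : Fin d := ⟨D a - 1, by omega⟩
    have hj : (j : ℕ) + 1 = D a := by simp only [j]; omega
    have hcard : ∀ v, ((insert a T).filter fun r => D r = v).card =
        (T.filter fun r => D r = v).card + if D a = v then 1 else 0 := by
      intro v
      rw [Finset.filter_insert]
      split_ifs with h
      · rw [Finset.card_insert_of_notMem (by simp [ha])]
      · rfl
    have h0 : (T.filter fun r => D r = D a) = ∅ := by
      rw [Finset.filter_eq_empty_iff]
      intro r hr h
      have := hinj (by simp [hr]) (by simp) h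
      exact ha (this ▸ hr)
    unfold ffProd
    rw [← Finset.mul_prod_erase _ _ (Finset.mem_univ j),
      ← Finset.mul_prod_erase (Finset.univ) (fun j : Fin d => ffPow d j _) (Finset.mem_univ j)]
    have hrest : ∀ i ∈ Finset.univ.erase j,
        ffPow d i (ξ (i + 1) + (T.filter fun r => D r = i + 1).card) =
        ffPow d i (ξ (i + 1) + ((insert a T).filter fun r => D r = i + 1).card) := by
      intro i hi
      rw [hcard, if_neg, add_zero]
      intro h
      exact (Finset.mem_erase.1 hi).1 (Fin.ext (by omega))
    rw [Finset.prod_congr rfl hrest]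
    simp only [hcard]
    rw [hj, h0, if_pos rfl, ← hj, xv_succ]
    simp only [Finset.card_empty, add_zero, zero_add, ffPow, Finset.prod_range_succ]
    ring

/-! ### Linear independence of alternants -/

/-- The substitution `x_v ↦ y_{ζ(v)+1}`. -/
def evalAt {d : ℕ} (ζ : ℕ → ℕ) : P d →ₐ[ℂ] P d :=
  aeval (Sum.elim (fun j : Fin d => yI d ((ζ (j + 1) : ℤ) + 1)) (fun i => yI d i))

lemma evalAt_ySub {d : ℕ} (ζ : ℕ → ℕ) {q : P d} (hq : q ∈ ySub d) : evalAt ζ q = q := by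
  have : ySub d ≤ AlgHom.equalizer (evalAt ζ) (AlgHom.id ℂ (P d)) := by
    refine Algebra.adjoin_le ?_
    rintro _ ⟨i, rfl⟩
    simp [evalAt, yI]
  exact this hq

lemma permX_ySub {d : ℕ} (σ : Equiv.Perm (Fin d)) {q : P d} (hq : q ∈ ySub d) :
    permX σ q = q := by
  have : ySub d ≤ AlgHom.equalizer (permX σ) (AlgHom.id ℂ (P d)) := by
    refine Algebra.adjoin_le ?_
    rintro _ ⟨i, rfl⟩
    simp
  exact this hq

lemma yI_mem_ySub (d : ℕ) (i : ℤ) : yI d i ∈ ySub d := Algebra.subset_adjoin ⟨i, rfl⟩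

lemma evalAt_ffPow {d : ℕ} (ζ : ℕ → ℕ) (j : Fin d) (k : ℕ) :
    evalAt ζ (ffPow d j k) =
      ∏ i ∈ Finset.range k, (yI d ((ζ (j + 1) : ℤ) + 1) - yI d ((i : ℤ) + 1)) := by
  simp [evalAt, ffPow, map_prod, yI]

lemma yI_sub_ne_zero {d : ℕ} {i j : ℤ} (h : i ≠ j) : yI d i - yI d j ≠ 0 := by
  intro h0
  have := X_injective (R := ℂ) (sub_eq_zero.1 h0)
  exact h (Sum.inr_injective this)

lemma evalAt_ffPow_eq_zero_iff {d : ℕ} (ζ : ℕ → ℕ) (j : Fin d) (k : ℕ) :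
    evalAt ζ (ffPow d j k) = 0 ↔ ζ (j + 1) < k := by
  rw [evalAt_ffPow, Finset.prod_eq_zero_iff]
  constructor
  · rintro ⟨i, hi, h⟩
    by_contra hc
    refine yI_sub_ne_zero ?_ h
    have := Finset.mem_range.1 hi
    omega
  · intro h
    exact ⟨ζ (j + 1), Finset.mem_range.2 h, by simp⟩

lemma evalAt_alternant {d : ℕ} (ζ ξ : ℕ → ℕ) : evalAt ζ (alternant d ξ) =
    ∑ σ : Equiv.Perm (Fin d), ((Equiv.Perm.sign σ : ℤ) : ℂ) •
      ∏ j : Fin d, evalAt ζ (ffPow d (σ j) (ξ (j + 1))) := by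
  simp [alternant, alt_apply, ffProd, map_prod, map_sum]

/-- The exponents are strictly decreasing on the values `1,…,d`. -/
def StrictDesc (d : ℕ) (ξ : ℕ → ℕ) : Prop := ∀ v, 1 ≤ v → v < d → ξ (v + 1) < ξ v

lemma StrictDesc.strictAnti {d : ℕ} {ξ : ℕ → ℕ} (h : StrictDesc d ξ) :
    StrictAnti (fun j : Fin d => ξ (j + 1)) := by
  have : ∀ n a : ℕ, 1 ≤ a → a + n + 1 ≤ d → ξ (a + n + 1) < ξ a := by
    intro n
    induction n with
    | zero => intro a h1 h2; exact h a h1 (by omega)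
    | succ n ih => intro a h1 h2; exact (h (a + n + 1) (by omega) (by omega)).trans (ih a h1 (by omega))
  intro i j hij
  obtain ⟨n, hn⟩ := Nat.exists_eq_add_of_lt (Fin.lt_def.1 hij)
  have := this n (i + 1) (by omega) (by omega)
  have e : (i : ℕ) + 1 + n + 1 = j + 1 := by omega
  rwa [e] at this

lemma perm_eq_one_of_strictAnti {d : ℕ} {f : Fin d → ℕ} (hf : StrictAnti f)
    {σ : Equiv.Perm (Fin d)} (h : StrictAnti (f ∘ σ)) : σ = 1 := by
  have hσ : StrictMono σ := fun i j hij => hf.lt_iff_gt.1 (h hij)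
  ext i
  have := Subsingleton.elim (hσ.orderIsoOfSurjective σ σ.surjective) (OrderIso.refl (Fin d))
  have h2 := DFunLike.congr_fun this i
  exact congrArg Fin.val h2

lemma evalAt_alternant_eq_zero {d : ℕ} {ζ ξ : ℕ → ℕ} (hζ : StrictDesc d ζ) (hξ : StrictDesc d ξ)
    (hle : ∑ j : Fin d, ζ (j + 1) ≤ ∑ j : Fin d, ξ (j + 1))
    (hne : ∃ j : Fin d, ξ (j + 1) ≠ ζ (j + 1)) :
    evalAt ζ (alternant d ξ) = 0 := by
  rw [evalAt_alternant]
  refine Finset.sum_eq_zero fun σ _ => ?_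
  have : ∏ j : Fin d, evalAt ζ (ffPow d (σ j) (ξ (j + 1))) = 0 := by
    by_contra hc
    rw [Finset.prod_eq_zero_iff] at hc
    push Not at hc
    have hall : ∀ j : Fin d, ξ (j + 1) ≤ ζ (σ j + 1) := by
      intro j
      have := hc j (Finset.mem_univ j)
      rw [Ne, evalAt_ffPow_eq_zero_iff] at this
      omega
    have hs : ∑ j : Fin d, ζ (σ j + 1) = ∑ j : Fin d, ζ (j + 1) :=
      Equiv.sum_comp σ (fun j : Fin d => ζ (j + 1))
    have heq : ∀ j ∈ Finset.univ, ξ ((j : Fin d) + 1) = ζ (σ j + 1) := by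
      rw [← Finset.sum_eq_sum_iff_of_le fun j _ => hall j]
      exact le_antisymm (Finset.sum_le_sum fun j _ => hall j) (hs ▸ hle)
    have h1 : σ = 1 := by
      refine perm_eq_one_of_strictAnti hζ.strictAnti ?_
      have : ((fun j : Fin d => ζ (j + 1)) ∘ σ) = fun j : Fin d => ξ (j + 1) := by
        funext j; exact (heq j (Finset.mem_univ j)).symm
      rw [this]
      exact hξ.strictAnti
    obtain ⟨j, hj⟩ := hne
    apply hj
    rw [heq j (Finset.mem_univ j), h1]
    rfl
  rw [this, smul_zero]

lemma evalAt_alternant_self_ne_zero {d : ℕ} {ζ : ℕ → ℕ} (hζ : StrictDesc d ζ) :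
    evalAt ζ (alternant d ζ) ≠ 0 := by
  rw [evalAt_alternant, Finset.sum_eq_single 1]
  · simp only [Equiv.Perm.sign_one, Units.val_one, Int.cast_one, one_smul, Equiv.Perm.coe_one, id]
    rw [Finset.prod_ne_zero_iff]
    intro j _
    rw [Ne, evalAt_ffPow_eq_zero_iff]
    exact lt_irrefl _
  · intro σ _ hσ
    have : ∏ j : Fin d, evalAt ζ (ffPow d (σ j) (ζ (j + 1))) = 0 := by
      by_contra hc
      rw [Finset.prod_eq_zero_iff] at hc
      push Not at hc
      have hall : ∀ j : Fin d, ζ (j + 1) ≤ ζ (σ j + 1) := by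
        intro j
        have := hc j (Finset.mem_univ j)
        rw [Ne, evalAt_ffPow_eq_zero_iff] at this
        omega
      have hs : ∑ j : Fin d, ζ (σ j + 1) = ∑ j : Fin d, ζ (j + 1) :=
        Equiv.sum_comp σ (fun j : Fin d => ζ (j + 1))
      have heq : ∀ j ∈ Finset.univ, ζ ((j : Fin d) + 1) = ζ (σ j + 1) := by
        rw [← Finset.sum_eq_sum_iff_of_le fun j _ => hall j]
        exact hs.symm
      apply hσ
      refine perm_eq_one_of_strictAnti hζ.strictAnti ?_
      have : ((fun j : Fin d => ζ (j + 1)) ∘ σ) = fun j : Fin d => ζ (j + 1) := by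
        funext j; exact (heq j (Finset.mem_univ j)).symm
      rw [this]
      exact hζ.strictAnti
    rw [this, smul_zero]
  · simp

/-- The exponents `η + ρ`, indexed by values `1,…,d`. -/
def addRho {d : ℕ} (η : Fin d → ℕ) (v : ℕ) : ℕ := vecAt η v + (d - v)

lemma vecAt_succ {d : ℕ} (η : Fin d → ℕ) (j : Fin d) : vecAt η (j + 1) = η j := by
  simp [vecAt]

lemma vecAt_anti {d : ℕ} {η : Fin d → ℕ} (h : IsPartitionVec η) {v : ℕ} (h1 : 1 ≤ v)
    (h2 : v < d) : vecAt η (v + 1) ≤ vecAt η v := by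
  simp only [vecAt]
  rw [dif_pos (by omega), dif_pos (by omega)]
  exact h _ _ (Fin.mk_le_mk.2 (by omega))

lemma IsPartitionVec.strictDesc {d : ℕ} {η : Fin d → ℕ} (h : IsPartitionVec η) :
    StrictDesc d (addRho η) := by
  intro v h1 h2
  have := vecAt_anti h h1 h2
  simp only [addRho]
  omega

lemma alternant_independent {d : ℕ} (q : (Fin d → ℕ) →₀ P d)
    (hq : ∀ η ∈ q.support, IsPartitionVec η ∧ q η ∈ ySub d)
    (h0 : (q.sum fun η b => b * alternant d (addRho η)) = 0) : q = 0 := by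
  by_contra hne
  obtain ⟨ζ, hζ, hmin⟩ := Finset.exists_min_image q.support wt (Finsupp.support_nonempty_iff.2 hne)
  have h1 := congrArg (evalAt (addRho ζ)) h0
  rw [map_zero, Finsupp.sum, map_sum, Finset.sum_eq_single_of_mem ζ hζ] at h1
  · rw [map_mul, evalAt_ySub _ (hq ζ hζ).2] at h1
    rcases mul_eq_zero.1 h1 with h | h
    · exact Finsupp.mem_support_iff.1 hζ h
    · exact evalAt_alternant_self_ne_zero (hq ζ hζ).1.strictDesc h
  · intro η hη hηζ
    rw [map_mul, evalAt_alternant_eq_zero (hq ζ hζ).1.strictDesc (hq η hη).1.strictDesc, mul_zero]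
    · simp only [addRho, vecAt_succ, Finset.sum_add_distrib]
      exact Nat.add_le_add_right (hmin η hη) _
    · by_contra hc
      push Not at hc
      apply hηζ
      funext j
      have := hc j
      simp only [addRho, vecAt_succ] at this
      omega

/-! ### Columns and the column-by-column expansion of the factorial Schur function -/

lemma finite_columns (d h : ℕ) : {D : ℕ → ℕ | (∀ r < h, 1 ≤ D r ∧ D r ≤ d) ∧ (∀ r, h ≤ r → D r = 0) ∧
    ∀ r, r + 1 < h → D (r + 1) < D r}.Finite := by
  refine Set.Finite.of_injOn (f := fun D (i : Fin h) => D i)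
    (t := {g : Fin h → ℕ | ∀ i, g i ∈ Set.Iic d}) ?_ ?_ (Set.Finite.pi' fun _ => Set.finite_Iic d)
  · intro D hD i
    exact (hD.1 i i.2).2
  · intro D hD E hE hDE
    funext r
    by_cases hr : r < h
    · exact congrFun hDE ⟨r, hr⟩
    · rw [hD.2.1 r (by omega), hE.2.1 r (by omega)]

/-- Columns of height `h` (rows indexed from the bottom) with entries in `{1,…,d}`, strictly
increasing from top to bottom; they are extended by `0`. -/
def columns (d h : ℕ) : Finset (ℕ → ℕ) := (finite_columns d h).toFinset

lemma mem_columns {d h : ℕ} {D : ℕ → ℕ} : D ∈ columns d h ↔ (∀ r < h, 1 ≤ D r ∧ D r ≤ d) ∧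
    (∀ r, h ≤ r → D r = 0) ∧ ∀ r, r + 1 < h → D (r + 1) < D r := by
  simp [columns]

lemma columns_lt {d h : ℕ} {D : ℕ → ℕ} (hD : D ∈ columns d h) {r s : ℕ} (hrs : r < s) (hs : s < h) :
    D s < D r := by
  obtain ⟨n, rfl⟩ := Nat.exists_eq_add_of_lt hrs
  clear hrs
  induction n with
  | zero => exact (mem_columns.1 hD).2.2 r hs
  | succ n ih => exact ((mem_columns.1 hD).2.2 (r + n + 1) hs).trans (ih (by omega))

lemma columns_lt_height {d h : ℕ} {D : ℕ → ℕ} (hD : D ∈ columns d h) {r : ℕ} (hr : D r ≠ 0) :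
    r < h := by
  by_contra hc
  exact hr ((mem_columns.1 hD).2.1 r (by omega))

lemma columns_inj {d h : ℕ} {D : ℕ → ℕ} (hD : D ∈ columns d h) {r s : ℕ} (hr : r < h) (hs : s < h)
    (h' : D r = D s) : r = s := by
  rcases lt_trichotomy r s with hlt | heq | hgt
  · exact absurd h' (columns_lt hD hlt hs).ne'
  · exact heq
  · exact absurd h' (columns_lt hD hgt hr).ne

/-- The weight of a column placed at (0-based) column index `c`. -/
def colWt (d h c : ℕ) (D : ℕ → ℕ) : P d := ∏ r ∈ Finset.range h, factor d (D r) (r, c)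

/-- The sum of weights of fillings of `n` consecutive columns starting at column `c`, of heights
given by `H`, each row being bounded by the column `C` to the right. -/
def colSum (d : ℕ) (H : ℕ → ℕ) : ℕ → ℕ → (ℕ → ℕ) → P d
  | 0, _, _ => 1
  | n + 1, c, C => ∑ D ∈ (columns d (H c)).filter (fun D => ∀ r < H c, D r ≤ C r),
      colWt d (H c) c D * colSum d H n (c + 1) D

/-- Every entry `p+1` of the column `C` has an entry `p+2` directly below it. -/
def Paired (p : ℕ) (C : ℕ → ℕ) : Prop := ∀ r, C r = p + 1 → 1 ≤ r ∧ C (r - 1) = p + 2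

lemma permX_factor {d p v : ℕ} (hp : p + 1 < d) (h1 : 1 ≤ v) (h2 : v ≤ d) (hv : v ≠ p + 1)
    (hv' : v ≠ p + 2) (a : ℕ × ℕ) : permX (adjSwap hp) (factor d v a) = factor d v a := by
  rw [factor, map_sub, permX_xv hp h1 h2 hv hv', permX_yI]

lemma permX_prod_factor {d p h c : ℕ} (hp : p + 1 < d) {D : ℕ → ℕ} (hD : D ∈ columns d h)
    {T : Finset ℕ} (hT : ∀ r ∈ T, r < h ∧ D r ≠ p + 1 ∧ D r ≠ p + 2) :
    permX (adjSwap hp) (∏ r ∈ T, factor d (D r) (r, c)) = ∏ r ∈ T, factor d (D r) (r, c) := by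
  rw [map_prod]
  refine Finset.prod_congr rfl fun r hr => ?_
  obtain ⟨h0, h1, h2⟩ := hT r hr
  obtain ⟨h3, h4⟩ := (mem_columns.1 hD).1 r h0
  exact permX_factor hp h3 h4 h1 h2 _

/-- A column containing `p+1` and `p+2` is `Paired`. -/
lemma paired_of_mem {d h p s : ℕ} {D : ℕ → ℕ} (hD : D ∈ columns d h) (hs : D s = p + 2) :
    Paired p D := by
  intro r hr
  have hrh := columns_lt_height hD (r := r) (by omega)
  have hsh := columns_lt_height hD (r := s) (by omega)
  have hsr : s < r := by
    rcases lt_trichotomy r s with hlt | heq | hgt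
    · have := columns_lt hD hlt hsh; omega
    · subst heq; omega
    · exact hgt
  have h1 := columns_lt hD (r := r - 1) (s := r) (by omega) hrh
  refine ⟨by omega, ?_⟩
  by_cases h2 : s = r - 1
  · rw [← h2, hs]
  · have := columns_lt hD (r := s) (s := r - 1) (by omega) (by omega)
    omega

lemma permX_colWt_of_pair {d h c p r : ℕ} (hp : p + 1 < d) {D : ℕ → ℕ} (hD : D ∈ columns d h)
    (hr : D (r + 1) = p + 1) (hr' : D r = p + 2) :
    permX (adjSwap hp) (colWt d h c D) = colWt d h c D := by
  have h1 : r + 1 ∈ Finset.range h := Finset.mem_range.2 (columns_lt_height hD (by omega))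
  have h2 : r ∈ (Finset.range h).erase (r + 1) := by
    have := Finset.mem_range.1 h1
    simp; omega
  rw [colWt, ← Finset.mul_prod_erase _ _ h1, ← Finset.mul_prod_erase _ _ h2, map_mul, map_mul,
    permX_prod_factor hp hD]
  · rw [hr, hr']
    simp only [factor, map_sub, permX_xv_left, permX_xv_right, permX_yI]
    have e : (d : ℤ) + 1 - ((p + 1 : ℕ) : ℤ) + (c : ℤ) - ((r + 1 : ℕ) : ℤ) =
        (d : ℤ) + 1 - ((p + 2 : ℕ) : ℤ) + (c : ℤ) - (r : ℤ) := by push_cast; ring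
    rw [e]
    ring
  · intro s hs
    simp only [Finset.mem_erase, Finset.mem_range] at hs
    refine ⟨hs.2.2, fun h0 => hs.2.1 ?_, fun h0 => hs.1 ?_⟩
    · exact columns_inj hD hs.2.2 (Finset.mem_range.1 h1) (h0.trans hr.symm)
    · exact columns_inj hD hs.2.2 (by have := Finset.mem_range.1 h1; omega) (h0.trans hr'.symm)

/-- The column contains exactly one of `p+1`, `p+2`. -/
def Lone (p : ℕ) (D : ℕ → ℕ) : Prop := Xor (∃ r, D r = p + 1) (∃ r, D r = p + 2)

lemma permX_colWt_of_not_lone {d h c p : ℕ} (hp : p + 1 < d) {D : ℕ → ℕ} (hD : D ∈ columns d h)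
    (hl : ¬ Lone p D) : permX (adjSwap hp) (colWt d h c D) = colWt d h c D ∧ Paired p D := by
  by_cases h1 : ∃ r, D r = p + 1
  · have h2 : ∃ r, D r = p + 2 := by
      by_contra h2
      exact hl (Or.inl ⟨h1, h2⟩)
    obtain ⟨r, hr⟩ := h1
    obtain ⟨s, hs⟩ := h2
    have hpair := paired_of_mem hD hs
    obtain ⟨h3, h4⟩ := hpair r hr
    refine ⟨permX_colWt_of_pair hp hD (r := r - 1) ?_ h4, hpair⟩
    rwa [Nat.sub_add_cancel h3]
  · have h2 : ¬ ∃ r, D r = p + 2 := fun h2 => hl (Or.inr ⟨h2, h1⟩)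
    push Not at h1 h2
    exact ⟨permX_prod_factor hp hD fun r hr => ⟨Finset.mem_range.1 hr, h1 r, h2 r⟩,
      fun r hr => absurd hr (h1 r)⟩

lemma swapVal_swapVal (i v : ℕ) : swapVal i (swapVal i v) = v := by
  simp only [swapVal]; split_ifs <;> omega

lemma swapVal_comp_swapVal_comp (i : ℕ) (D : ℕ → ℕ) : swapVal i ∘ swapVal i ∘ D = D := by
  funext r; exact swapVal_swapVal i (D r)

lemma Lone.swap {p : ℕ} {D : ℕ → ℕ} (h : Lone p D) : Lone p (swapVal (p + 1) ∘ D) := by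
  have h1 : ∀ v, swapVal (p + 1) v = p + 1 ↔ v = p + 2 := by
    intro v; simp only [swapVal]; split_ifs <;> omega
  have h2 : ∀ v, swapVal (p + 1) v = p + 2 ↔ v = p + 1 := by
    intro v; simp only [swapVal]; split_ifs <;> omega
  simp only [Lone, Function.comp, h1, h2]
  exact (xor_comm _ _).mp h

lemma Lone.swap_mem {d h p : ℕ} (hp : p + 1 < d) {D : ℕ → ℕ} (hl : Lone p D)
    (hD : D ∈ columns d h) : swapVal (p + 1) ∘ D ∈ columns d h := by
  have hD' := mem_columns.1 hD
  refine mem_columns.2 ⟨fun r hr => ?_, fun r hr => ?_, fun r hr => ?_⟩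
  · have := hD'.1 r hr
    simp only [swapVal, Function.comp]
    split_ifs <;> omega
  · have := hD'.2.1 r hr
    simp only [swapVal, Function.comp]
    split_ifs <;> omega
  · have := hD'.2.2 r hr
    have hn : ¬ (D (r + 1) = p + 1 ∧ D r = p + 2) := by
      rintro ⟨ha, hb⟩
      rcases hl with ⟨_, h⟩ | ⟨_, h⟩
      · exact h ⟨_, hb⟩
      · exact h ⟨_, ha⟩
    simp only [swapVal, Function.comp]
    split_ifs <;> omega

lemma colSum_lone_difference {d p n c r : ℕ} {H : ℕ → ℕ} (hp : p + 1 < d)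
    (ih : ∀ c C, Paired p C → permX (adjSwap hp) (colSum d H n c C) = colSum d H n c C)
    {h : ℕ} {D : ℕ → ℕ} (hD : D ∈ columns d h) (hr : D r = p + 2) (hl : ∀ s, D s ≠ p + 1) :
    ∃ Q : P d, permX (adjSwap hp) Q = Q ∧
      colSum d H (n + 1) c D = colSum d H (n + 1) c (swapVal (p + 1) ∘ D) +
        factor d (p + 2) (r, c) * Q := by
  set D' := swapVal (p + 1) ∘ D with hD'
  have hrh := columns_lt_height hD (r := r) (by omega)
  have hD'r : D' r = p + 1 := by simp [hD', swapVal, hr]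
  have hD's : ∀ s, s ≠ r → D' s = D s := by
    intro s hs
    have h1 := hl s
    have h2 : D s ≠ p + 2 := by
      intro h2
      exact hs (columns_inj hD (columns_lt_height hD (by omega)) hrh (h2.trans hr.symm))
    simp [hD', swapVal, h1, h2]
  let S := (columns d (H c)).filter fun E => (∀ s < H c, E s ≤ D s) ∧ E r = p + 2
  have hsplit : (columns d (H c)).filter (fun E => ∀ s < H c, E s ≤ D s) =
      ((columns d (H c)).filter fun E => ∀ s < H c, E s ≤ D' s) ∪ S := by
    ext E
    simp only [S, Finset.mem_union, Finset.mem_filter, ← and_or_left]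
    refine and_congr_right fun hE => ⟨fun hle => ?_, fun hle => ?_⟩
    · by_cases hEr : E r = p + 2
      · exact Or.inr ⟨hle, hEr⟩
      · refine Or.inl fun s hs => ?_
        by_cases hsr : s = r
        · subst hsr; rw [hD'r]; have := hle s hs; omega
        · rw [hD's s hsr]; exact hle s hs
    · rcases hle with hle | hle
      · intro s hs
        by_cases hsr : s = r
        · subst hsr; have := hle s hs; omega
        · rw [← hD's s hsr]; exact hle s hs
      · exact hle.1
  have hdisj : Disjoint ((columns d (H c)).filter fun E => ∀ s < H c, E s ≤ D' s) S := by
    rw [Finset.disjoint_left]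
    intro E hE hE'
    simp only [S, Finset.mem_filter] at hE hE'
    have := hE.2 r (columns_lt_height hE.1 (by omega))
    omega
  refine ⟨∑ E ∈ S, (∏ s ∈ (Finset.range (H c)).erase r, factor d (E s) (s, c)) *
    colSum d H n (c + 1) E, ?_, ?_⟩
  · rw [map_sum]
    refine Finset.sum_congr rfl fun E hE => ?_
    simp only [S, Finset.mem_filter] at hE
    have hErh := columns_lt_height hE.1 (r := r) (by omega)
    have hne : ∀ s, E s ≠ p + 1 := by
      intro s hs
      have hsh := columns_lt_height hE.1 (r := s) (by omega)
      have h1 := hE.2.1 s hsh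
      have hsr : r < s := by
        rcases lt_trichotomy r s with hlt | heq | hgt
        · exact hlt
        · subst heq; omega
        · have := columns_lt hE.1 hgt hErh; omega
      have h2 := columns_lt hD hsr (columns_lt_height hD (by omega))
      have := hl s
      omega
    rw [map_mul, ih _ _ (fun s hs => absurd hs (hne s)), permX_prod_factor hp hE.1]
    intro s hs
    simp only [Finset.mem_erase, Finset.mem_range] at hs
    exact ⟨hs.2, hne s, fun h2 => hs.1 (columns_inj hE.1 hs.2 hErh (h2.trans hE.2.2.symm))⟩
  · rw [colSum, hsplit, Finset.sum_union hdisj, colSum, Finset.mul_sum]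
    congr 1
    refine Finset.sum_congr rfl fun E hE => ?_
    simp only [S, Finset.mem_filter] at hE
    have hErh := columns_lt_height hE.1 (r := r) (by omega)
    rw [colWt, ← Finset.mul_prod_erase _ _ (Finset.mem_range.2 hErh), hE.2.2, mul_assoc]

lemma permX_lone_pair {d p n c r h : ℕ} {H : ℕ → ℕ} (hp : p + 1 < d)
    (ih : ∀ m ≤ n, ∀ c C, Paired p C → permX (adjSwap hp) (colSum d H m c C) = colSum d H m c C)
    {D : ℕ → ℕ} (hD : D ∈ columns d h) (hr : D r = p + 2) (hl : ∀ s, D s ≠ p + 1) :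
    permX (adjSwap hp) (colWt d h c D * colSum d H n (c + 1) D +
      colWt d h c (swapVal (p + 1) ∘ D) * colSum d H n (c + 1) (swapVal (p + 1) ∘ D)) =
    colWt d h c D * colSum d H n (c + 1) D +
      colWt d h c (swapVal (p + 1) ∘ D) * colSum d H n (c + 1) (swapVal (p + 1) ∘ D) := by
  have hrh := columns_lt_height hD (r := r) (by omega)
  have hne : ∀ s < h, s ≠ r → D s ≠ p + 2 := fun s hs hsr h2 =>
    hsr (columns_inj hD hs hrh (h2.trans hr.symm))
  have hD's : ∀ s < h, s ≠ r → swapVal (p + 1) (D s) = D s := by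
    intro s hs hsr
    simp [swapVal, hl s, hne s hs hsr]
  have hw1 : colWt d h c D = factor d (p + 2) (r, c) *
      ∏ s ∈ (Finset.range h).erase r, factor d (D s) (s, c) := by
    rw [colWt, ← Finset.mul_prod_erase _ _ (Finset.mem_range.2 hrh), hr]
  have hw2 : colWt d h c (swapVal (p + 1) ∘ D) = factor d (p + 1) (r, c) *
      ∏ s ∈ (Finset.range h).erase r, factor d (D s) (s, c) := by
    rw [colWt, ← Finset.mul_prod_erase _ _ (Finset.mem_range.2 hrh)]
    congr 1
    · simp [swapVal, hr]
    · refine Finset.prod_congr rfl fun s hs => ?_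
      simp only [Finset.mem_erase, Finset.mem_range] at hs
      rw [Function.comp, hD's s hs.2 hs.1]
  have hw0 : permX (adjSwap hp) (∏ s ∈ (Finset.range h).erase r, factor d (D s) (s, c)) =
      ∏ s ∈ (Finset.range h).erase r, factor d (D s) (s, c) := by
    refine permX_prod_factor hp hD fun s hs => ?_
    simp only [Finset.mem_erase, Finset.mem_range] at hs
    exact ⟨hs.2, hl s, hne s hs.2 hs.1⟩
  have hF := ih n le_rfl (c + 1) D (fun s hs => absurd hs (hl s))
  obtain ⟨Q, hQ, hdiff⟩ : ∃ Q : P d, permX (adjSwap hp) Q = Q ∧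
      colSum d H n (c + 1) D = colSum d H n (c + 1) (swapVal (p + 1) ∘ D) +
        factor d (p + 2) (r, c + 1) * Q := by
    cases n with
    | zero => exact ⟨0, map_zero _, by simp [colSum]⟩
    | succ n => exact colSum_lone_difference hp (ih n (by omega)) hD hr hl
  rw [hw1, hw2, ← sub_eq_iff_eq_add.2 hdiff]
  generalize (∏ s ∈ (Finset.range h).erase r, factor d (D s) (s, c)) = w at hw0 ⊢
  have e : (d : ℤ) + 1 - ((p + 1 : ℕ) : ℤ) + (c : ℤ) - (r : ℤ) =
      (d : ℤ) + 1 - ((p + 2 : ℕ) : ℤ) + ((c + 1 : ℕ) : ℤ) - (r : ℤ) := by push_cast; ring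
  simp only [map_add, map_mul, map_sub, hw0, hQ, hF, factor, permX_xv_left, permX_xv_right,
    permX_yI, e]
  ring

/-- The column sums are symmetric in neighbouring `x` variables. -/
lemma permX_colSum {d p : ℕ} (H : ℕ → ℕ) (hp : p + 1 < d) (n : ℕ) : ∀ c C, Paired p C →
    permX (adjSwap hp) (colSum d H n c C) = colSum d H n c C := by
  induction n using Nat.strong_induction_on with
  | _ n ih =>
  intro c C hC
  cases n with
  | zero => simp [colSum]
  | succ n =>
  rw [colSum, map_sum, ← sub_eq_zero, ← Finset.sum_sub_distrib]
  have hcase : ∀ D ∈ columns d (H c), Lone p D →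
      permX (adjSwap hp) (colWt d (H c) c D * colSum d H n (c + 1) D +
      colWt d (H c) c (swapVal (p + 1) ∘ D) * colSum d H n (c + 1) (swapVal (p + 1) ∘ D)) =
      colWt d (H c) c D * colSum d H n (c + 1) D +
      colWt d (H c) c (swapVal (p + 1) ∘ D) * colSum d H n (c + 1) (swapVal (p + 1) ∘ D) := by
    intro D hD hl
    have hih : ∀ m ≤ n, ∀ c C, Paired p C →
      permX (adjSwap hp) (colSum d H m c C) = colSum d H m c C := fun m hm => ih m (by omega)
    rcases hl with ⟨⟨r, hr⟩, h2⟩ | ⟨⟨r, hr⟩, h2⟩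
    · have h3 := permX_lone_pair (c := c) (r := r) hp hih (Lone.swap_mem hp (Or.inl ⟨⟨r, hr⟩, h2⟩) hD)
        (by simp [swapVal, hr]) (by
          intro s hs
          simp only [swapVal, Function.comp] at hs
          split_ifs at hs with h4 h5
          · omega
          · exact h2 ⟨s, h5⟩
          · exact h4 hs)
      rw [swapVal_comp_swapVal_comp] at h3
      rw [add_comm]
      exact h3
    · exact permX_lone_pair hp hih hD hr (fun s hs => h2 ⟨s, hs⟩)
  refine Finset.sum_involution (fun D _ => if Lone p D then swapVal (p + 1) ∘ D else D) ?_ ?_ ?_ ?_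
  · intro D hD
    rw [Finset.mem_filter] at hD
    split_ifs with hl
    · have := hcase D hD.1 hl
      rw [map_add] at this
      linear_combination this
    · have hw := permX_colWt_of_not_lone (c := c) hp hD.1 hl
      rw [map_mul, hw.1, ih n (by omega) _ _ hw.2]
      ring
  · intro D hD hne
    rw [Finset.mem_filter] at hD
    split_ifs with hl
    · intro heq
      rcases hl with ⟨⟨r, hr⟩, _⟩ | ⟨⟨r, hr⟩, _⟩
      · have := congrFun heq r
        simp [swapVal, hr] at this
      · have := congrFun heq r
        simp [swapVal, hr] at this
    · exfalso
      apply hne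
      have hw := permX_colWt_of_not_lone (c := c) hp hD.1 hl
      rw [map_mul, hw.1, ih n (by omega) _ _ hw.2, sub_self]
  · intro D hD
    rw [Finset.mem_filter] at hD ⊢
    split_ifs with hl
    · refine ⟨hl.swap_mem hp hD.1, fun r hr => ?_⟩
      have h1 := hD.2 r hr
      by_cases hDr : D r = p + 1
      · have hD' : swapVal (p + 1) (D r) = p + 2 := by simp [swapVal, hDr]
        rw [Function.comp, hD']
        by_contra hc
        have h2 : C r = p + 1 := by omega
        obtain ⟨h3, h4⟩ := hC r h2
        have h5 := hD.2 (r - 1) (by omega)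
        have h6 := columns_lt hD.1 (r := r - 1) (s := r) (by omega) hr
        rcases hl with ⟨_, h⟩ | ⟨_, h⟩
        · exact h ⟨r - 1, by omega⟩
        · exact h ⟨r, hDr⟩
      · simp only [swapVal, Function.comp]
        split_ifs <;> omega
    · exact hD
  · intro D hD
    by_cases hl : Lone p D
    · simp only [if_pos hl, if_pos hl.swap, swapVal_comp_swapVal_comp]
    · simp only [if_neg hl]

/-! ### Sums over paths -/

section Paths

variable {X R : Type*} [CommSemiring R]

/-- Sequences whose `j`-th term lies in `Xs j` for `j < n` and is `x0` afterwards. -/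
def paths (x0 : X) (Xs : ℕ → Finset X) : ℕ → Finset (ℕ → X)
  | 0 => {fun _ => x0}
  | n + 1 => (paths x0 Xs n ×ˢ Xs n).image fun q => Function.update q.1 n q.2

lemma mem_paths {x0 : X} {Xs : ℕ → Finset X} {n : ℕ} : ∀ {g : ℕ → X}, g ∈ paths x0 Xs n ↔
    (∀ j < n, g j ∈ Xs j) ∧ ∀ j, n ≤ j → g j = x0 := by
  induction n with
  | zero =>
    intro g
    simp [paths, funext_iff]
  | succ n ih =>
    intro g
    simp only [paths, Finset.mem_image, Finset.mem_product, Prod.exists, ih]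
    constructor
    · rintro ⟨f, x, ⟨⟨h1, h2⟩, h3⟩, rfl⟩
      refine ⟨fun j hj => ?_, fun j hj => ?_⟩
      · by_cases h : j = n
        · subst h; simpa using h3
        · rw [Function.update_of_ne h]; exact h1 j (by omega)
      · rw [Function.update_of_ne (by omega)]; exact h2 j (by omega)
    · rintro ⟨h1, h2⟩
      refine ⟨Function.update g n x0, g n, ⟨⟨fun j hj => ?_, fun j hj => ?_⟩, h1 n (by omega)⟩, ?_⟩
      · rw [Function.update_of_ne (by omega)]; exact h1 j (by omega)
      · by_cases h : j = n
        · subst h; simp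
        · rw [Function.update_of_ne h]; exact h2 j (by omega)
      · simp

lemma sum_paths_succ (x0 : X) (Xs : ℕ → Finset X) (n : ℕ) (φ : (ℕ → X) → R) :
    ∑ g ∈ paths x0 Xs (n + 1), φ g =
      ∑ g ∈ paths x0 Xs n, ∑ x ∈ Xs n, φ (Function.update g n x) := by
  rw [paths, Finset.sum_image, Finset.sum_product]
  rintro ⟨f, x⟩ hf ⟨f', x'⟩ hf' h
  simp only [Finset.coe_product, Set.mem_prod, Finset.mem_coe, mem_paths] at hf hf' h
  have hx : x = x' := by simpa using congrFun h n
  refine Prod.ext ?_ hx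
  funext j
  by_cases hj : j = n
  · subst hj
    exact (hf.1.2 j le_rfl).trans (hf'.1.2 j le_rfl).symm
  · simpa [Function.update_of_ne hj] using congrFun h j

/-- Iterating a one-step expansion yields a sum over paths. -/
lemma eq_sum_paths (x0 : X) (Xs : ℕ → Finset X) (w Φ : ℕ → (ℕ → X) → R)
    (hw : ∀ j c g x, j < c → w j (Function.update g c x) = w j g) (N : ℕ)
    (h : ∀ c < N, ∀ g ∈ paths x0 Xs c, (∏ j ∈ Finset.range c, w j g) ≠ 0 →
      Φ c g = ∑ x ∈ Xs c, w c (Function.update g c x) * Φ (c + 1) (Function.update g c x)) :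
    Φ 0 (fun _ => x0) = ∑ g ∈ paths x0 Xs N, (∏ j ∈ Finset.range N, w j g) * Φ N g := by
  induction N with
  | zero => simp [paths]
  | succ N ih =>
    rw [ih fun c hc => h c (by omega), sum_paths_succ]
    refine Finset.sum_congr rfl fun g hg => ?_
    by_cases h0 : (∏ j ∈ Finset.range N, w j g) = 0
    · rw [h0, zero_mul, Finset.sum_eq_zero]
      intro x _
      rw [Finset.prod_range_succ, Finset.prod_congr rfl fun j hj => hw j N g x (Finset.mem_range.1 hj),
        h0, zero_mul, zero_mul]
    · rw [h N (by omega) g hg h0, Finset.mul_sum]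
      refine Finset.sum_congr rfl fun x _ => ?_
      rw [Finset.prod_range_succ, Finset.prod_congr rfl fun j hj => hw j N g x (Finset.mem_range.1 hj),
        mul_assoc]

/-- The term of a sequence preceding index `c`, with a default value at `c = 0`. -/
def prevTerm (x : X) (g : ℕ → X) : ℕ → X
  | 0 => x
  | c + 1 => g c

@[simp] lemma prevTerm_zero (x : X) (g : ℕ → X) : prevTerm x g 0 = x := rfl

@[simp] lemma prevTerm_succ (x : X) (g : ℕ → X) (c : ℕ) : prevTerm x g (c + 1) = g c := rfl

lemma prevTerm_update (x y : X) (g : ℕ → X) {j c : ℕ} (h : j ≤ c) :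
    prevTerm x (Function.update g c y) j = prevTerm x g j := by
  cases j with
  | zero => rfl
  | succ j => simp only [prevTerm]; rw [Function.update_of_ne (by omega)]

end Paths

/-! ### Column heights -/

lemma mem_cells {d : ℕ} {mu : Fin d → ℕ} {a : ℕ × ℕ} :
    a ∈ cells d mu ↔ ∃ h : a.1 < d, a.2 < mu ⟨a.1, h⟩ := by
  simp only [cells, Finset.mem_filter, Finset.mem_product, Finset.mem_range]
  refine ⟨fun h => h.2, fun ⟨h, h'⟩ => ⟨⟨h, ?_⟩, h, h'⟩⟩
  have := Finset.le_sup (f := mu) (Finset.mem_univ ⟨a.1, h⟩)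
  omega

lemma exists_not_mem_cells {d : ℕ} (mu : Fin d → ℕ) (c : ℕ) : ∃ r, (r, c) ∉ cells d mu :=
  ⟨d, fun h => by obtain ⟨h, _⟩ := mem_cells.1 h; exact lt_irrefl d h⟩

/-- The height of column `c` of the diagram. -/
def colHeight {d : ℕ} (mu : Fin d → ℕ) (c : ℕ) : ℕ := Nat.find (exists_not_mem_cells mu c)

lemma IsPartitionVec.mem_cells_iff {d : ℕ} {mu : Fin d → ℕ} (hmu : IsPartitionVec mu) {r c : ℕ} :
    (r, c) ∈ cells d mu ↔ r < colHeight mu c := by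
  rw [colHeight, Nat.lt_find_iff]
  refine ⟨fun h m hm => not_not.2 ?_, fun h => not_not.1 (h r le_rfl)⟩
  obtain ⟨h1, h2⟩ := mem_cells.1 h
  exact mem_cells.2 ⟨by simp at h1 ⊢; omega, h2.trans_le (hmu _ _ hm)⟩

lemma colHeight_le {d : ℕ} (mu : Fin d → ℕ) (c : ℕ) : colHeight mu c ≤ d := by
  rw [colHeight, Nat.find_le_iff]
  exact ⟨d, le_rfl, fun h => by obtain ⟨h, _⟩ := mem_cells.1 h; exact lt_irrefl d h⟩

lemma lt_sup_of_mem_cells {d : ℕ} {mu : Fin d → ℕ} {a : ℕ × ℕ} (h : a ∈ cells d mu) :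
    a.2 < Finset.univ.sup mu := by
  obtain ⟨h1, h2⟩ := mem_cells.1 h
  exact h2.trans_le (Finset.le_sup (Finset.mem_univ _))

lemma IsPartitionVec.colHeight_succ_le {d : ℕ} {mu : Fin d → ℕ} (hmu : IsPartitionVec mu) (c : ℕ) :
    colHeight mu (c + 1) ≤ colHeight mu c := by
  by_contra h
  have h1 := hmu.mem_cells_iff.2 (not_le.1 h)
  obtain ⟨h2, h3⟩ := mem_cells.1 h1
  exact lt_irrefl _ (hmu.mem_cells_iff.1 (mem_cells.2 ⟨h2, by simp at h3 ⊢; omega⟩))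

lemma IsPartitionVec.colHeight_eq_zero {d : ℕ} {mu : Fin d → ℕ} (hmu : IsPartitionVec mu) {c : ℕ}
    (hc : Finset.univ.sup mu ≤ c) : colHeight mu c = 0 := by
  by_contra h0
  have := lt_sup_of_mem_cells (hmu.mem_cells_iff.2 (Nat.pos_of_ne_zero h0))
  exact absurd this hc.not_gt

@[to_additive]
lemma IsPartitionVec.prod_cells {d : ℕ} {mu : Fin d → ℕ} (hmu : IsPartitionVec mu) {R : Type*}
    [CommMonoid R] (f : ℕ × ℕ → R) : ∏ a ∈ cells d mu, f a =
      ∏ c ∈ Finset.range (Finset.univ.sup mu), ∏ r ∈ Finset.range (colHeight mu c), f (r, c) := by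
  refine Finset.prod_finset_product_right _ _ _ fun a => ?_
  simp only [Finset.mem_range, ← hmu.mem_cells_iff]
  exact ⟨fun h => ⟨lt_sup_of_mem_cells h, h⟩, fun h => h.2⟩

/-! ### The factorial Schur function as a column sum -/

lemma fSchur_eq_colSum {d : ℕ} {mu : Fin d → ℕ} (hmu : IsPartitionVec mu) : fSchur d mu =
    colSum d (colHeight mu) (Finset.univ.sup mu) 0 (fun _ => d + 1) := by
  set N := Finset.univ.sup mu with hN
  set H := colHeight mu with hH
  have hcell : ∀ {r c : ℕ}, (r, c) ∈ cells d mu ↔ r < H c := hmu.mem_cells_iff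
  let ok : (ℕ → ℕ → ℕ) → ℕ → Prop := fun g c => ∀ r < H c, g c r ≤ prevTerm (fun _ => d + 1) g c r
  have key := eq_sum_paths (R := P d) (fun _ => 0) (fun c => columns d (H c))
    (fun c g => if ok g c then colWt d (H c) c (g c) else 0)
    (fun c g => colSum d H (N - c) c (prevTerm (fun _ => d + 1) g c)) (by
      intro j c g x hj
      simp only [ok, prevTerm_update _ _ _ hj.le, Function.update_of_ne hj.ne]) N (by
      intro c hc g hg _
      obtain ⟨n, hn⟩ : ∃ n, N - c = n + 1 := ⟨N - c - 1, by omega⟩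
      have hn' : N - (c + 1) = n := by omega
      rw [hn, hn', colSum, Finset.sum_filter]
      refine Finset.sum_congr rfl fun D _ => ?_
      simp only [ok, prevTerm_update _ _ _ le_rfl, Function.update_self, prevTerm_succ, ite_mul, zero_mul])
  simp only [Nat.sub_zero, prevTerm_zero, Nat.sub_self, colSum, mul_one] at key
  rw [key]
  have hp : ∀ g, (∏ j ∈ Finset.range N, if ok g j then colWt d (H j) j (g j) else 0) =
      if ∀ j < N, ok g j then ∏ j ∈ Finset.range N, colWt d (H j) j (g j) else 0 := by
    intro g
    split_ifs with h
    · exact Finset.prod_congr rfl fun j hj => if_pos (h j (Finset.mem_range.1 hj))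
    · push Not at h
      obtain ⟨j, hj, hj'⟩ := h
      exact Finset.prod_eq_zero (Finset.mem_range.2 hj) (if_neg hj')
  simp only [hp]
  rw [← Finset.sum_filter, ← finsum_mem_coe_finset, fSchur, ← finsum_mem_univ]
  refine finsum_mem_eq_of_bijOn (fun R c r => R.val (r, c)) ⟨?_, ?_, ?_⟩ ?_
  · intro R _
    simp only [Finset.coe_filter, Set.mem_ofPred_eq, mem_paths]
    refine ⟨⟨fun c hc => mem_columns.2 ⟨fun r hr => ?_, fun r hr => ?_, fun r hr => ?_⟩,
      fun c hc => ?_⟩, fun c hc r hr => ?_⟩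
    · exact R.mem _ (hcell.2 hr)
    · exact R.zero _ (by rw [hcell]; omega)
    · exact R.col _ _ (hcell.2 hr)
    · funext r
      exact R.zero _ fun h => by have := lt_sup_of_mem_cells h; simp only at this; omega
    · have hm := hcell.2 hr
      cases c with
      | zero => exact (R.mem _ hm).2.trans (Nat.le_succ d)
      | succ c => exact R.row _ _ hm
  · intro R _ R' _ h
    have : R.val = R'.val := by
      funext a
      exact congrFun (congrFun h a.2) a.1
    cases R; cases R'; simp only at this; subst this; rfl
  · intro g hg
    simp only [Finset.coe_filter, Set.mem_ofPred_eq, mem_paths] at hg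
    obtain ⟨⟨h1, h2⟩, h3⟩ := hg
    have hc : ∀ c, g c ∈ columns d (H c) := by
      intro c
      by_cases hc : c < N
      · exact h1 c hc
      · rw [h2 c (by omega), show H c = 0 from hmu.colHeight_eq_zero (not_lt.1 hc)]
        exact mem_columns.2 ⟨by simp, by simp, by simp⟩
    refine ⟨⟨fun a => g a.2 a.1, fun a ha => ?_, fun a ha => ?_, fun r c ha => ?_,
      fun r c ha => ?_⟩, trivial, rfl⟩
    · exact (mem_columns.1 (hc a.2)).1 _ (hcell.1 ha)
    · exact (mem_columns.1 (hc a.2)).2.1 _ (by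
        have := mt (hcell (r := a.1) (c := a.2)).2 ha; omega)
    · exact h3 (c + 1) (lt_sup_of_mem_cells ha) r (hcell.1 ha)
    · exact (mem_columns.1 (hc c)).2.2 _ (hcell.1 ha)
  · intro R _
    exact hmu.prod_cells _

/-! ### Expansion of an alternant times a factorial Schur function -/

lemma permX_fSchur {d : ℕ} {mu : Fin d → ℕ} (hmu : IsPartitionVec mu) (σ : Equiv.Perm (Fin d)) :
    permX σ (fSchur d mu) = fSchur d mu := by
  rw [fSchur_eq_colSum hmu]
  exact permX_of_adjSwap (fun p hp => permX_colSum _ hp _ _ _ fun r hr => by omega) σ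

/-- A column together with its set of barred rows. -/
abbrev BarredCol := (ℕ → ℕ) × Finset ℕ

/-- The columns of height `h` with some of their entries barred. -/
def barredColumns (d h : ℕ) : Finset BarredCol := columns d h ×ˢ (Finset.range h).powerset

/-- The number of unbarred entries `v` of a barred column. -/
def plainCount (h : ℕ) (x : BarredCol) (v : ℕ) : ℕ :=
  ((Finset.range h \ x.2).filter fun r => x.1 r = v).card

/-- The exponent vector `ξ` increased by the content of the unbarred entries of the first `c`
columns. -/
def expo (H : ℕ → ℕ) (ξ : ℕ → ℕ) (c : ℕ) (g : ℕ → BarredCol) (v : ℕ) : ℕ :=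
  ξ v + ∑ j ∈ Finset.range c, plainCount (H j) (g j) v

/-- The weight of the barred entries of column `c`. -/
def barWt (d : ℕ) (H ξ : ℕ → ℕ) (c : ℕ) (g : ℕ → BarredCol) : P d :=
  ∏ r ∈ (g c).2, (yI d ((expo H ξ c g ((g c).1 r) : ℤ) + 1) -
    yI d ((d : ℤ) + 1 - ((g c).1 r : ℤ) + (c : ℤ) - (r : ℤ)))

/-- Column `c` is bounded by the preceding one, and the exponents after column `c` are strictly
decreasing. -/
def Admissible (d : ℕ) (H ξ : ℕ → ℕ) (c : ℕ) (g : ℕ → BarredCol) : Prop :=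
  (∀ r < H c, (g c).1 r ≤ prevTerm (fun _ => d + 1) (fun j => (g j).1) c r) ∧
    StrictDesc d (expo H ξ (c + 1) g)

/-- The weight of column `c`, zero if it is not admissible. -/
def stepWt (d : ℕ) (H ξ : ℕ → ℕ) (c : ℕ) (g : ℕ → BarredCol) : P d :=
  if Admissible d H ξ c g then barWt d H ξ c g else 0

lemma expo_zero (H ξ : ℕ → ℕ) (g : ℕ → BarredCol) : expo H ξ 0 g = ξ := by
  funext v; simp [expo]

lemma expo_succ (H ξ : ℕ → ℕ) (c : ℕ) (g : ℕ → BarredCol) :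
    expo H ξ (c + 1) g = fun v => expo H ξ c g v + plainCount (H c) (g c) v := by
  funext v; simp [expo, Finset.sum_range_succ, add_assoc]

lemma expo_update (H ξ : ℕ → ℕ) {c c' : ℕ} (h : c ≤ c') (g : ℕ → BarredCol) (x : BarredCol) :
    expo H ξ c (Function.update g c' x) = expo H ξ c g := by
  funext v
  simp only [expo]
  congr 1
  refine Finset.sum_congr rfl fun j hj => ?_
  rw [Finset.mem_range] at hj
  rw [Function.update_of_ne (by omega)]

lemma prevTerm_update_fst (x : ℕ → ℕ) (y : BarredCol) (g : ℕ → BarredCol) {j c : ℕ} (h : j ≤ c) :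
    prevTerm x (fun i => (Function.update g c y i).1) j = prevTerm x (fun i => (g i).1) j := by
  cases j with
  | zero => rfl
  | succ j => simp only [prevTerm_succ]; rw [Function.update_of_ne (by omega)]

lemma stepWt_update (d : ℕ) (H ξ : ℕ → ℕ) {c c' : ℕ} (h : c < c') (g : ℕ → BarredCol)
    (x : BarredCol) : stepWt d H ξ c (Function.update g c' x) = stepWt d H ξ c g := by
  rw [stepWt, stepWt]
  refine if_congr ?_ ?_ rfl
  · simp only [Admissible, prevTerm_update_fst _ _ _ h.le, Function.update_of_ne h.ne,
      expo_update H ξ (show c + 1 ≤ c' from h)]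
  · simp only [barWt, Function.update_of_ne h.ne, expo_update H ξ h.le]

lemma plainCount_le_one {d h : ℕ} {D : ℕ → ℕ} (hD : D ∈ columns d h) (S : Finset ℕ) (v : ℕ) :
    plainCount h (D, S) v ≤ 1 := by
  rw [plainCount, Finset.card_le_one]
  intro r hr s hs
  simp only [Finset.mem_filter, Finset.mem_sdiff, Finset.mem_range] at hr hs
  exact columns_inj hD hr.1.1 hs.1.1 (hr.2.trans hs.2.symm)

lemma plainCount_pos {h v : ℕ} {x : BarredCol} (hv : 0 < plainCount h x v) :
    ∃ r < h, r ∉ x.2 ∧ x.1 r = v := by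
  obtain ⟨r, hr⟩ := Finset.card_pos.1 hv
  simp only [Finset.mem_filter, Finset.mem_sdiff, Finset.mem_range] at hr
  exact ⟨r, hr.1.1, hr.1.2, hr.2⟩

lemma plainCount_pos_of {h r : ℕ} {x : BarredCol} (hr : r < h) (hx : r ∉ x.2) :
    0 < plainCount h x (x.1 r) := by
  refine Finset.card_pos.2 ⟨r, ?_⟩
  simp [hr, hx]

lemma ffProd_mul_colWt {d h : ℕ} (c : ℕ) (ξ : ℕ → ℕ) {D : ℕ → ℕ} (hD : D ∈ columns d h) :
    ffProd d ξ * colWt d h c D = ∑ S ∈ (Finset.range h).powerset,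
      (∏ r ∈ S, (yI d ((ξ (D r) : ℤ) + 1) - yI d ((d : ℤ) + 1 - (D r : ℤ) + (c : ℤ) - (r : ℤ)))) *
        ffProd d (fun v => ξ v + plainCount h (D, S) v) := by
  have h1 : colWt d h c D = ∏ r ∈ Finset.range h,
      ((yI d ((ξ (D r) : ℤ) + 1) - yI d ((d : ℤ) + 1 - (D r : ℤ) + (c : ℤ) - (r : ℤ))) +
        (xv d (D r) - yI d ((ξ (D r) : ℤ) + 1))) := by
    refine Finset.prod_congr rfl fun r _ => ?_
    rw [factor]
    ring
  rw [h1, Finset.prod_add, Finset.mul_sum]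
  refine Finset.sum_congr rfl fun S _ => ?_
  have h2 := ffProd_mul_prod (d := d) ξ (Finset.range h \ S) D
    (fun r hr => (mem_columns.1 hD).1 r (Finset.mem_range.1 (Finset.mem_sdiff.1 hr).1))
    (fun r hr s hs => columns_inj hD (Finset.mem_range.1 (Finset.mem_sdiff.1 hr).1)
      (Finset.mem_range.1 (Finset.mem_sdiff.1 hs).1))
  simp only [plainCount]
  rw [← h2]
  ring

lemma alt_eq_zero_of_not_strictDesc {d h n c : ℕ} {H ξ D : ℕ → ℕ} {S : Finset ℕ}
    (hξ : StrictDesc d ξ) (hD : D ∈ columns d h)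
    (hn : ¬ StrictDesc d (fun v => ξ v + plainCount h (D, S) v)) :
    alt (ffProd d (fun v => ξ v + plainCount h (D, S) v) * colSum d H n c D) = 0 := by
  simp only [StrictDesc, not_forall, not_lt] at hn
  obtain ⟨v, h1, h2, h3⟩ := hn
  obtain ⟨p, rfl⟩ : ∃ p, v = p + 1 := ⟨v - 1, by omega⟩
  have h4 := hξ _ h1 h2
  have h5 := plainCount_le_one hD S (p + 1 + 1)
  obtain ⟨r, _, _, hr⟩ := plainCount_pos (h := h) (x := (D, S)) (v := p + 2) (by
    change 0 < plainCount h (D, S) (p + 1 + 1)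
    omega)
  refine alt_eq_zero_of_swap (i := ⟨p, by omega⟩) (j := ⟨p + 1, h2⟩) (by simp) ?_
  change permX (adjSwap h2) _ = _
  rw [map_mul, permX_ffProd h2 (by change _ = ξ (p + 1 + 1) + plainCount h (D, S) (p + 1 + 1); omega),
    permX_colSum H h2 n c D (paired_of_mem hD hr)]

lemma barWt_mem_ySub (d : ℕ) (H ξ : ℕ → ℕ) (c : ℕ) (g : ℕ → BarredCol) :
    barWt d H ξ c g ∈ ySub d :=
  Subalgebra.prod_mem _ fun _ _ => Subalgebra.sub_mem _ (yI_mem_ySub _ _) (yI_mem_ySub _ _)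

lemma stepWt_mem_ySub (d : ℕ) (H ξ : ℕ → ℕ) (c : ℕ) (g : ℕ → BarredCol) :
    stepWt d H ξ c g ∈ ySub d := by
  rw [stepWt]
  split_ifs
  · exact barWt_mem_ySub _ _ _ _ _
  · exact Subalgebra.zero_mem _

/-- Sequences of `N` barred columns of heights `H 0, H 1, …`. -/
def barredPaths (d : ℕ) (H : ℕ → ℕ) (N : ℕ) : Finset (ℕ → BarredCol) :=
  paths (fun _ => 0, ∅) (fun c => barredColumns d (H c)) N

lemma alt_ffProd_mul_colSum {d : ℕ} (H : ℕ → ℕ) {ξ : ℕ → ℕ} (hξ : StrictDesc d ξ) (N : ℕ) :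
    alt (ffProd d ξ * colSum d H N 0 (fun _ => d + 1)) =
      ∑ g ∈ barredPaths d H N, (∏ j ∈ Finset.range N, stepWt d H ξ j g) *
        alternant d (expo H ξ N g) := by
  have key := eq_sum_paths (R := P d) (fun _ => 0, ∅) (fun c => barredColumns d (H c)) (stepWt d H ξ)
    (fun c g => alt (ffProd d (expo H ξ c g) *
      colSum d H (N - c) c (prevTerm (fun _ => d + 1) (fun j => (g j).1) c)))
    (fun j c g x hj => stepWt_update d H ξ hj g x) N (by
      intro c hc g hg h0
      have hs : StrictDesc d (expo H ξ c g) := by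
        cases c with
        | zero => rwa [expo_zero]
        | succ c =>
          by_contra hn
          exact h0 (Finset.prod_eq_zero (Finset.self_mem_range_succ c)
            (if_neg fun hA => hn hA.2))
      obtain ⟨n, hn⟩ : ∃ n, N - c = n + 1 := ⟨N - c - 1, by omega⟩
      have hn' : N - (c + 1) = n := by omega
      rw [hn, hn', colSum, Finset.mul_sum, map_sum, Finset.sum_filter, barredColumns,
        Finset.sum_product]
      refine Finset.sum_congr rfl fun D hD => ?_
      simp only [stepWt, Admissible, barWt, prevTerm_update_fst _ _ _ le_rfl, Function.update_self,
        prevTerm_succ, expo_succ, expo_update H ξ le_rfl]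
      split_ifs with hle
      · rw [← mul_assoc, ffProd_mul_colWt c _ hD, Finset.sum_mul, map_sum]
        refine Finset.sum_congr rfl fun S _ => ?_
        rw [mul_assoc, alt_mul_of_symm fun σ => permX_ySub σ (Subalgebra.prod_mem _ fun _ _ =>
          Subalgebra.sub_mem _ (yI_mem_ySub _ _) (yI_mem_ySub _ _))]
        split_ifs with hA
        · rfl
        · rw [alt_eq_zero_of_not_strictDesc hs hD fun h => hA ⟨hle, h⟩, mul_zero, zero_mul]
      · symm
        refine Finset.sum_eq_zero fun S _ => ?_
        rw [if_neg fun h => hle h.1, zero_mul])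
  simpa only [Nat.sub_zero, prevTerm_zero, Nat.sub_self, colSum, mul_one, expo_zero, barredPaths,
    alternant] using key

lemma alternant_mul_fSchur {d : ℕ} {mu : Fin d → ℕ} (hmu : IsPartitionVec mu) {ξ : ℕ → ℕ}
    (hξ : StrictDesc d ξ) : alternant d ξ * fSchur d mu =
      ∑ g ∈ barredPaths d (colHeight mu) (Finset.univ.sup mu),
        (∏ j ∈ Finset.range (Finset.univ.sup mu), stepWt d (colHeight mu) ξ j g) *
          alternant d (expo (colHeight mu) ξ (Finset.univ.sup mu) g) := by
  rw [← alt_ffProd_mul_colSum _ hξ, ← fSchur_eq_colSum hmu, alternant, mul_comm,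
    ← alt_mul_of_symm (permX_fSchur hmu), mul_comm]

/-! ### The bialternant formula -/

/-- The column of height `h` with entries `1, …, h`, none barred. -/
def plainCol (h : ℕ) : BarredCol := (fun r => h - r, ∅)

lemma plainCount_plainCol (h v : ℕ) (hv : 1 ≤ v) :
    plainCount h (plainCol h) v = if v ≤ h then 1 else 0 := by
  simp only [plainCount, plainCol, Finset.sdiff_empty]
  split_ifs with hvh
  · rw [Finset.card_eq_one]
    refine ⟨h - v, ?_⟩
    ext r
    simp only [Finset.mem_filter, Finset.mem_range, Finset.mem_singleton]
    omega
  · rw [Finset.card_eq_zero, Finset.filter_eq_empty_iff]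
    intro r _
    omega

lemma plainCol_mem {d h : ℕ} (hd : h ≤ d) : plainCol h ∈ barredColumns d h := by
  simp only [barredColumns, plainCol, Finset.mem_product, mem_columns, Finset.mem_powerset,
    Finset.empty_subset, and_true]
  refine ⟨fun r hr => by omega, fun r hr => by omega, fun r hr => by omega⟩

lemma expo_plainCol (H ξ : ℕ → ℕ) (c v : ℕ) (hv : 1 ≤ v) (g : ℕ → BarredCol)
    (hg : ∀ j < c, g j = plainCol (H j)) :
    expo H ξ c g v = ξ v + ((Finset.range c).filter fun j => v ≤ H j).card := by
  rw [expo, Finset.card_filter]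
  congr 1
  refine Finset.sum_congr rfl fun j hj => ?_
  rw [hg j (Finset.mem_range.1 hj), plainCount_plainCol _ _ hv]

lemma columns_add_le {d h : ℕ} {D : ℕ → ℕ} (hD : D ∈ columns d h) {r : ℕ} (hr : r < h) :
    D r + r ≤ D 0 := by
  induction r with
  | zero => omega
  | succ r ih =>
    have h1 := ih (by omega)
    have h2 := (mem_columns.1 hD).2.2 r hr
    omega

lemma columns_ge {d h : ℕ} {D : ℕ → ℕ} (hD : D ∈ columns d h) {r : ℕ} (hr : r < h) :
    h ≤ D r + r := by
  obtain ⟨n, hn⟩ : ∃ n, h = r + n + 1 := ⟨h - r - 1, by omega⟩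
  clear hr
  induction n generalizing r with
  | zero =>
    have := (mem_columns.1 hD).1 r (by omega)
    omega
  | succ n ih =>
    have h1 := ih (r := r + 1) (by omega)
    have h2 := (mem_columns.1 hD).2.2 r (by omega)
    omega

/-- A barred column whose bottom entry is unbarred, and whose unbarred values form an initial
segment, is plain. -/
lemma eq_plainCol {d h : ℕ} {x : BarredCol} (hx : x ∈ barredColumns d h)
    (h0 : 0 < h → 0 ∉ x.2)
    (hdown : ∀ r < h, r ∉ x.2 → ∀ v, 1 ≤ v → x.1 r = v + 1 → ∃ s < h, s ∉ x.2 ∧ x.1 s = v) :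
    x = plainCol h := by
  obtain ⟨D, S⟩ := x
  simp only [barredColumns, Finset.mem_product, Finset.mem_powerset] at hx
  obtain ⟨hD, hS⟩ := hx
  simp only at h0 hdown hD hS
  rcases Nat.eq_zero_or_pos h with rfl | hpos
  · refine Prod.ext ?_ ?_
    · funext r
      simpa [plainCol] using (mem_columns.1 hD).2.1 r (by omega)
    · simpa [plainCol] using hS
  have hall : ∀ n v, 1 ≤ v → v + n = D 0 → ∃ s < h, s ∉ S ∧ D s = v := by
    intro n
    induction n with
    | zero => intro v _ hv; exact ⟨0, hpos, h0 hpos, by omega⟩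
    | succ n ih =>
      intro v hv hvn
      obtain ⟨s, hs, hsS, hDs⟩ := ih (v + 1) (by omega) (by omega)
      exact hdown s hs hsS v hv hDs
  have hall' : ∀ v, 1 ≤ v → v ≤ D 0 → ∃ s < h, s ∉ S ∧ D s = v := fun v h1 h2 =>
    hall (D 0 - v) v h1 (by omega)
  have hD0 : D 0 ≤ h := by
    have hsub : Finset.Icc 1 (D 0) ⊆ (Finset.range h).image D := by
      intro v hv
      rw [Finset.mem_Icc] at hv
      obtain ⟨s, hs, _, hDs⟩ := hall' v hv.1 hv.2
      exact Finset.mem_image.2 ⟨s, Finset.mem_range.2 hs, hDs⟩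
    have := (Finset.card_le_card hsub).trans Finset.card_image_le
    simpa using this
  refine Prod.ext ?_ ?_
  · funext r
    simp only [plainCol]
    by_cases hr : r < h
    · have h1 := columns_add_le hD hr
      have h2 := columns_ge hD hr
      omega
    · rw [(mem_columns.1 hD).2.1 r (by omega)]
      omega
  · simp only [plainCol, Finset.eq_empty_iff_forall_notMem]
    intro r hr
    have hrh := Finset.mem_range.1 (hS hr)
    obtain ⟨s, hs, hsS, hDs⟩ := hall' (D r) ((mem_columns.1 hD).1 r hrh).1
      (by have := columns_add_le hD hrh; omega)
    exact hsS (columns_inj hD hs hrh hDs ▸ hr)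

lemma IsPartitionVec.colHeight_anti {d : ℕ} {mu : Fin d → ℕ} (hmu : IsPartitionVec mu) :
    Antitone (colHeight mu) := antitone_nat_of_succ_le hmu.colHeight_succ_le

lemma mem_barredPaths {d N : ℕ} {H : ℕ → ℕ} {g : ℕ → BarredCol} : g ∈ barredPaths d H N ↔
    (∀ j < N, g j ∈ barredColumns d (H j)) ∧ ∀ j, N ≤ j → g j = (fun _ => 0, ∅) := mem_paths

lemma eq_plainCol_of_stepWt_ne_zero {d : ℕ} {mu : Fin d → ℕ} (hmu : IsPartitionVec mu)
    {g : ℕ → BarredCol} {c : ℕ} (hg : g c ∈ barredColumns d (colHeight mu c))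
    (hprev : ∀ j < c, g j = plainCol (colHeight mu j))
    (hw : stepWt d (colHeight mu) (fun v => d - v) c g ≠ 0) : g c = plainCol (colHeight mu c) := by
  have hA : Admissible d (colHeight mu) (fun v => d - v) c g := by
    by_contra hA
    exact hw (if_neg hA)
  rw [stepWt, if_pos hA, barWt, Finset.prod_ne_zero_iff] at hw
  have hD := (Finset.mem_product.1 hg).1
  have hexp : ∀ r < colHeight mu c, ∀ v, 1 ≤ v → v ≤ (g c).1 r →
      expo (colHeight mu) (fun v => d - v) c g v = d - v + c := by
    intro r hr v h1 hv
    rw [expo_plainCol _ _ _ _ h1 _ hprev, Finset.filter_true_of_mem, Finset.card_range]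
    intro j hj
    rw [Finset.mem_range] at hj
    obtain ⟨c', rfl⟩ : ∃ c', c = c' + 1 := ⟨c - 1, by omega⟩
    have h2 := hA.1 r hr
    rw [prevTerm_succ, hprev c' (by omega)] at h2
    simp only [plainCol] at h2
    have h3 := hmu.colHeight_anti (show j ≤ c' by omega)
    omega
  refine eq_plainCol hg (fun hpos h0 => hw 0 h0 ?_) fun r hr hrS v hv hrv => ?_
  · obtain ⟨h1, h2⟩ := (mem_columns.1 hD).1 0 hpos
    rw [hexp 0 hpos _ h1 le_rfl, sub_eq_zero]
    congr 1
    push_cast [h2]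
    ring
  · have h1 := (mem_columns.1 hD).1 r hr
    have h2 := hA.2 v hv (by omega)
    have h3 := hexp r hr (v + 1) (by omega) (by omega)
    have h4 := hexp r hr v hv (by omega)
    have h5 : 0 < plainCount (colHeight mu c) (g c) (v + 1) := hrv ▸ plainCount_pos_of hr hrS
    simp only [expo_succ, h3, h4] at h2
    exact plainCount_pos (by omega)

lemma alternant_rho_mul_fSchur {d : ℕ} {mu : Fin d → ℕ} (hmu : IsPartitionVec mu) :
    alternant d (fun v => d - v) * fSchur d mu = alternant d (addRho mu) := by
  have hρ : StrictDesc d (fun v => d - v) := fun v _ _ => by simp only; omega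
  set N := Finset.univ.sup mu with hN
  rw [alternant_mul_fSchur hmu hρ, ← hN,
    Finset.sum_eq_single (fun j => plainCol (colHeight mu j))]
  · have hw : ∀ c, stepWt d (colHeight mu) (fun v => d - v) c
        (fun j => plainCol (colHeight mu j)) = 1 := by
      intro c
      rw [stepWt, if_pos]
      · simp [barWt, plainCol]
      · refine ⟨fun r _ => ?_, fun v h1 h2 => ?_⟩
        · have hle := colHeight_le mu c
          cases c with
          | zero => simp only [prevTerm_zero, plainCol]; omega
          | succ c =>
            have := hmu.colHeight_succ_le c
            simp only [prevTerm_succ, plainCol]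
            omega
        · rw [expo_plainCol _ _ _ _ (by omega) _ fun _ _ => rfl,
            expo_plainCol _ _ _ _ (by omega) _ fun _ _ => rfl]
          have : ((Finset.range (c + 1)).filter fun j => v + 1 ≤ colHeight mu j).card ≤
              ((Finset.range (c + 1)).filter fun j => v ≤ colHeight mu j).card :=
            Finset.card_le_card (Finset.monotone_filter_right _ fun j _ hj => by omega)
          omega
    rw [Finset.prod_congr rfl fun c _ => hw c, Finset.prod_const_one, one_mul, alternant, alternant]
    congr 1
    refine ffProd_congr fun v h1 h2 => ?_
    rw [expo_plainCol _ _ _ _ h1 _ fun _ _ => rfl, addRho, vecAt, dif_pos (by omega), add_comm]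
    congr 1
    have : ((Finset.range N).filter fun j => v ≤ colHeight mu j) =
        Finset.range (mu ⟨v - 1, by omega⟩) := by
      ext j
      have h3 := hmu.mem_cells_iff (r := v - 1) (c := j)
      rw [mem_cells] at h3
      have h4 := Finset.le_sup (f := mu) (Finset.mem_univ ⟨v - 1, by omega⟩)
      simp only [Finset.mem_filter, Finset.mem_range]
      constructor
      · rintro ⟨_, h⟩
        obtain ⟨_, h5⟩ := h3.2 (by omega)
        exact h5
      · intro h
        have h5 := h3.1 ⟨by simp only; omega, h⟩
        omega
    rw [this, Finset.card_range]
  · intro g hg hne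
    rw [mem_barredPaths] at hg
    by_contra h0
    have hprod : (∏ j ∈ Finset.range N, stepWt d (colHeight mu) (fun v => d - v) j g) ≠ 0 := by
      intro h
      rw [h, zero_mul] at h0
      exact h0 rfl
    rw [Finset.prod_ne_zero_iff] at hprod
    refine hne (funext fun c => ?_)
    induction c using Nat.strong_induction_on with
    | _ c ih =>
      by_cases hc : c < N
      · exact eq_plainCol_of_stepWt_ne_zero hmu (hg.1 c hc) ih (hprod c (Finset.mem_range.2 hc))
      · rw [hg.2 c (by omega), hmu.colHeight_eq_zero (not_lt.1 hc)]
        simp [plainCol]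
  · intro h
    refine absurd (mem_barredPaths.2 ⟨fun j _ => plainCol_mem (colHeight_le mu j), fun j hj => ?_⟩) h
    rw [hmu.colHeight_eq_zero hj]
    simp [plainCol]

/-! ### Structure constants as sums over barred paths -/

/-- The partition `lam` increased by the content of the unbarred entries. -/
def plainContent {d : ℕ} (lam : Fin d → ℕ) (H : ℕ → ℕ) (N : ℕ) (g : ℕ → BarredCol) (i : Fin d) : ℕ :=
  lam i + ∑ j ∈ Finset.range N, plainCount (H j) (g j) (i + 1)

lemma expo_addRho {d : ℕ} (lam : Fin d → ℕ) (H : ℕ → ℕ) (N : ℕ) (g : ℕ → BarredCol) {v : ℕ}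
    (h1 : 1 ≤ v) (h2 : v ≤ d) :
    expo H (addRho lam) N g v = addRho (plainContent lam H N g) v := by
  obtain ⟨p, rfl⟩ : ∃ p, v = p + 1 := ⟨v - 1, by omega⟩
  simp only [expo, addRho, vecAt, plainContent]
  rw [dif_pos (by omega), dif_pos (by omega)]
  simp only [Nat.add_sub_cancel]
  omega

lemma StrictDesc.isPartitionVec {d : ℕ} {η : Fin d → ℕ} (h : StrictDesc d (addRho η)) :
    IsPartitionVec η := by
  cases d with
  | zero => exact fun i => i.elim0
  | succ n =>
    refine fun i j hij => (Fin.antitone_iff_succ_le (f := η)).2 (fun k => ?_) hij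
    have h1 := h (k + 1) (by omega) (by omega)
    have h2 := vecAt_succ η k.succ
    have h3 := vecAt_succ η k.castSucc
    simp only [Fin.val_succ, Fin.val_castSucc] at h2 h3
    simp only [addRho, h2, h3] at h1
    omega

lemma isPartitionVec_plainContent {d : ℕ} {lam : Fin d → ℕ} (hlam : IsPartitionVec lam)
    {H : ℕ → ℕ} {N : ℕ} {g : ℕ → BarredCol}
    (h : (∏ j ∈ Finset.range N, stepWt d H (addRho lam) j g) ≠ 0) :
    IsPartitionVec (plainContent lam H N g) := by
  refine StrictDesc.isPartitionVec fun v h1 h2 => ?_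
  rw [← expo_addRho _ _ _ _ h1 h2.le, ← expo_addRho _ _ _ _ (by omega) (by omega)]
  revert v
  change StrictDesc d _
  cases N with
  | zero =>
    rw [expo_zero]
    exact hlam.strictDesc
  | succ n =>
    by_contra hn
    exact h (Finset.prod_eq_zero (Finset.self_mem_range_succ n) (if_neg fun hA => hn hA.2))

lemma structure_constant_eq_sum {d : ℕ} {lam mu : Fin d → ℕ}
    (hlam : IsPartitionVec lam) (hmu : IsPartitionVec mu) (c : (Fin d → ℕ) →₀ P d)
    (hsupp : ∀ η ∈ c.support, IsPartitionVec η ∧ c η ∈ ySub d)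
    (hexp : fSchur d lam * fSchur d mu = c.sum fun η q => q * fSchur d η) (nu : Fin d → ℕ) :
    c nu = ∑ g ∈ (barredPaths d (colHeight mu) (Finset.univ.sup mu)).filter
        (fun g => plainContent lam (colHeight mu) (Finset.univ.sup mu) g = nu),
      ∏ j ∈ Finset.range (Finset.univ.sup mu), stepWt d (colHeight mu) (addRho lam) j g := by
  set N := Finset.univ.sup mu
  set H := colHeight mu
  set W : (ℕ → BarredCol) → P d := fun g => ∏ j ∈ Finset.range N, stepWt d H (addRho lam) j g with hW
  let q : (Fin d → ℕ) →₀ P d := ∑ g ∈ barredPaths d H N, Finsupp.single (plainContent lam H N g) (W g)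
  have hq : ∀ η, q η = ∑ g ∈ (barredPaths d H N).filter (fun g => plainContent lam H N g = η), W g := by
    intro η
    simp only [q, Finsupp.finsetSum_apply, Finsupp.single_apply, Finset.sum_filter]
  have hqsum : (q.sum fun η b => b * alternant d (addRho η)) =
      alternant d (addRho lam) * fSchur d mu := by
    rw [alternant_mul_fSchur hmu hlam.strictDesc, ← Finsupp.sum_finsetSum_index]
    · refine Finset.sum_congr rfl fun g _ => ?_
      rw [Finsupp.sum_single_index (zero_mul _), alternant, alternant]
      congr 2
      exact ffProd_congr fun v h1 h2 => (expo_addRho _ _ _ _ h1 h2).symm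
    · exact fun η => zero_mul _
    · exact fun η a b => add_mul _ _ _
  have hcsum : (c.sum fun η b => b * alternant d (addRho η)) =
      alternant d (addRho lam) * fSchur d mu := by
    rw [← alternant_rho_mul_fSchur hlam, mul_assoc, hexp, Finsupp.mul_sum]
    refine Finset.sum_congr rfl fun η hη => ?_
    simp only
    rw [← alternant_rho_mul_fSchur (hsupp η hη).1]
    ring
  have hsub : c - q = 0 := by
    refine alternant_independent _ (fun η hη => ⟨?_, ?_⟩) ?_
    · by_contra hn
      rw [Finsupp.mem_support_iff, Finsupp.sub_apply] at hη
      refine hη ?_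
      rw [Finsupp.notMem_support_iff.1 fun h => hn (hsupp η h).1, hq, Finset.sum_eq_zero, sub_zero]
      intro g hg
      by_contra h0
      exact hn ((Finset.mem_filter.1 hg).2 ▸ isPartitionVec_plainContent hlam h0)
    · rw [Finsupp.sub_apply]
      refine Subalgebra.sub_mem _ ?_ ?_
      · by_cases h : η ∈ c.support
        · exact (hsupp η h).2
        · rw [Finsupp.notMem_support_iff.1 h]
          exact Subalgebra.zero_mem _
      · rw [hq]
        exact Subalgebra.sum_mem _ fun g _ => Subalgebra.prod_mem _ fun j _ =>
          stepWt_mem_ySub _ _ _ _ _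
    · rw [Finsupp.sum_sub_index fun η a b => sub_mul _ _ _, hcsum, hqsum, sub_self]
  rw [sub_eq_zero.1 hsub, hq]

/-! ### Equivariant Littlewood–Richardson tableaux as barred paths -/

lemma IsPartitionVec.card_filter_cells {d : ℕ} {mu : Fin d → ℕ} (hmu : IsPartitionVec mu)
    (Q : ℕ × ℕ → Prop) [DecidablePred Q] : ((cells d mu).filter Q).card =
      ∑ c ∈ Finset.range (Finset.univ.sup mu),
        ((Finset.range (colHeight mu c)).filter fun r => Q (r, c)).card := by
  simp only [Finset.card_filter]
  exact hmu.sum_cells _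

lemma IsPartitionVec.card_filter_cells_prefix {d : ℕ} {mu : Fin d → ℕ} (hmu : IsPartitionVec mu)
    (Q : ℕ × ℕ → Prop) [DecidablePred Q] (T : ℕ → Prop) [DecidablePred T] {c : ℕ}
    (hc : c < Finset.univ.sup mu) :
    ((cells d mu).filter fun b => Q b ∧ (b.2 < c ∨ (b.2 = c ∧ T b.1))).card =
      (∑ j ∈ Finset.range c, ((Finset.range (colHeight mu j)).filter fun r => Q (r, j)).card) +
        ((Finset.range (colHeight mu c)).filter fun r => Q (r, c) ∧ T r).card := by
  rw [hmu.card_filter_cells, ← Finset.sum_subset (Finset.range_subset_range.2 hc),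
    Finset.sum_range_succ]
  · congr 1
    · refine Finset.sum_congr rfl fun j hj => ?_
      rw [Finset.mem_range] at hj
      simp [hj]
    · simp
  · intro j _ hj
    rw [Finset.mem_range, not_lt] at hj
    rw [Finset.card_eq_zero, Finset.filter_eq_empty_iff]
    rintro r _ ⟨_, h | h⟩
    · exact absurd h (by simp only; omega)
    · exact absurd h.1 (by simp only; omega)

namespace SkewBarredTableau

variable {d : ℕ} {lam mu : Fin d → ℕ}

/-- The barred columns of the `μ`-part of a skew barred tableau, read from right to left. -/
def toPath (L : SkewBarredTableau d lam mu) (c : ℕ) : BarredCol :=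
  (fun r => L.bot (r, c), (Finset.range (colHeight mu c)).filter fun r => L.barred (r, c))

lemma toPath_fst_mem (hmu : IsPartitionVec mu) (L : SkewBarredTableau d lam mu) (c : ℕ) :
    (L.toPath c).1 ∈ columns d (colHeight mu c) := by
  refine mem_columns.2 ⟨fun r hr => ?_, fun r hr => ?_, fun r hr => ?_⟩
  · exact L.bot_mem _ (hmu.mem_cells_iff.2 hr)
  · exact L.bot_zero _ (by rw [hmu.mem_cells_iff]; omega)
  · exact L.bot_col _ _ (hmu.mem_cells_iff.2 hr)

lemma toPath_mem (hmu : IsPartitionVec mu) (L : SkewBarredTableau d lam mu) :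
    L.toPath ∈ barredPaths d (colHeight mu) (Finset.univ.sup mu) := by
  refine mem_barredPaths.2 ⟨fun c _ => Finset.mem_product.2
    ⟨toPath_fst_mem hmu L c, Finset.mem_powerset.2 (Finset.filter_subset _ _)⟩, fun c hc => ?_⟩
  have h := hmu.colHeight_eq_zero hc
  refine Prod.ext (funext fun r => L.bot_zero _ ?_) (by simp [toPath, h])
  rw [hmu.mem_cells_iff, h]
  omega

lemma plainCount_toPath (L : SkewBarredTableau d lam mu) (c k : ℕ) :
    plainCount (colHeight mu c) (L.toPath c) k = ((Finset.range (colHeight mu c)).filter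
      fun r => ¬ L.barred (r, c) ∧ L.bot (r, c) = k).card := by
  rw [plainCount]
  congr 1
  ext r
  rw [Finset.mem_filter, Finset.mem_filter, Finset.mem_sdiff]
  simp only [toPath, Finset.mem_filter]
  tauto

/-- The number of unbarred entries `k` of column `c` in rows at or above `r`. -/
def partialCount (L : SkewBarredTableau d lam mu) (r c k : ℕ) : ℕ :=
  ((Finset.range (colHeight mu c)).filter
    fun s => (¬ L.barred (s, c) ∧ L.bot (s, c) = k) ∧ r ≤ s).card

lemma partialCount_le (L : SkewBarredTableau d lam mu) (r c k : ℕ) :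
    L.partialCount r c k ≤ plainCount (colHeight mu c) (L.toPath c) k := by
  rw [plainCount_toPath, partialCount]
  exact Finset.card_le_card (Finset.monotone_filter_right _ fun s _ hs => hs.1)

/-- The `λ`-part has every entry equal to its row index. -/
def TopCanonical (L : SkewBarredTableau d lam mu) : Prop := ∀ a ∈ cells d lam, L.top a = a.1 + 1

lemma TopCanonical.card_eq {L : SkewBarredTableau d lam mu} (h : L.TopCanonical) {k : ℕ}
    (hk : 1 ≤ k) : ((cells d lam).filter fun b => L.top b = k).card = vecAt lam k := by
  have h1 : (cells d lam).filter (fun b => L.top b = k) =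
      (Finset.range (vecAt lam k)).image fun c => (k - 1, c) := by
    ext ⟨r, c⟩
    simp only [Finset.mem_filter, Finset.mem_image, Finset.mem_range, Prod.mk.injEq]
    constructor
    · rintro ⟨h1, h2⟩
      have h3 := h _ h1
      obtain ⟨h4, h5⟩ := mem_cells.1 h1
      simp only at h3 h4 h5
      have h6 : k = r + 1 := by omega
      subst h6
      refine ⟨c, ?_, rfl, rfl⟩
      rw [vecAt, dif_pos (by omega)]
      exact h5
    · rintro ⟨c', h1, h2, rfl⟩
      subst h2
      rw [vecAt] at h1
      split_ifs at h1 with h2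
      · have h3 : (k - 1, c') ∈ cells d lam := mem_cells.2 ⟨h2, h1⟩
        refine ⟨h3, ?_⟩
        rw [h _ h3]
        simp only
        omega
      · omega
  rw [h1, Finset.card_image_of_injective _ fun a b hab => (Prod.mk.injEq _ _ _ _ ▸ hab).2,
    Finset.card_range]

lemma content_eq (hmu : IsPartitionVec mu) {L : SkewBarredTableau d lam mu} (h : L.TopCanonical)
    {k : ℕ} (hk : 1 ≤ k) : L.content k = vecAt lam k + ∑ j ∈ Finset.range (Finset.univ.sup mu),
      plainCount (colHeight mu j) (L.toPath j) k := by
  rw [content, h.card_eq hk, hmu.card_filter_cells]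
  simp only [plainCount_toPath]

lemma countUpTo_eq (hmu : IsPartitionVec mu) {L : SkewBarredTableau d lam mu} (h : L.TopCanonical)
    {k : ℕ} (hk : 1 ≤ k) {a : ℕ × ℕ} (ha : a ∈ cells d mu) : L.countUpTo a k = vecAt lam k +
      (∑ j ∈ Finset.range a.2, plainCount (colHeight mu j) (L.toPath j) k +
        L.partialCount a.1 a.2 k) := by
  rw [countUpTo, h.card_eq hk]
  simp only [plainCount_toPath, partialCount]
  rw [← hmu.card_filter_cells_prefix (fun b => ¬ L.barred b ∧ L.bot b = k) (fun r => a.1 ≤ r)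
    (lt_sup_of_mem_cells ha)]
  congr 2
  ext ⟨r, c⟩
  obtain ⟨r', c'⟩ := a
  rw [Finset.mem_filter, Finset.mem_filter]
  simp only [revBefore, and_assoc, Prod.mk.injEq]
  refine and_congr_right fun _ => and_congr_right fun _ => and_congr_right fun _ => ?_
  omega

lemma countBefore_eq (hmu : IsPartitionVec mu) {L : SkewBarredTableau d lam mu} (h : L.TopCanonical)
    {a : ℕ × ℕ} (ha : a ∈ cells d mu) : L.countBefore a (L.bot a) = vecAt lam (L.bot a) +
      ∑ j ∈ Finset.range a.2, plainCount (colHeight mu j) (L.toPath j) (L.bot a) := by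
  rw [countBefore, h.card_eq (L.bot_mem a ha).1]
  simp only [plainCount_toPath]
  have h1 := hmu.card_filter_cells_prefix (fun b => ¬ L.barred b ∧ L.bot b = L.bot a)
    (fun r => a.1 < r) (lt_sup_of_mem_cells ha)
  have h2 : ((Finset.range (colHeight mu a.2)).filter fun r =>
      (¬ L.barred (r, a.2) ∧ L.bot (r, a.2) = L.bot a) ∧ a.1 < r).card = 0 := by
    rw [Finset.card_eq_zero, Finset.filter_eq_empty_iff]
    rintro r hr ⟨⟨_, h3⟩, h4⟩
    exact (columns_lt (toPath_fst_mem hmu L a.2) h4 (Finset.mem_range.1 hr)).ne h3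
  rw [h2, add_zero] at h1
  rw [← h1]
  congr 2
  ext b
  rw [Finset.mem_filter, Finset.mem_filter]
  simp only [revBefore, and_assoc]

lemma expo_toPath (L : SkewBarredTableau d lam mu) (c v : ℕ) :
    expo (colHeight mu) (addRho lam) c L.toPath v =
      vecAt lam v + ∑ j ∈ Finset.range c, plainCount (colHeight mu j) (L.toPath j) v + (d - v) := by
  simp only [expo, addRho]
  omega

lemma succ_le_top (hlam : IsPartitionVec lam) (L : SkewBarredTableau d lam mu) (r c : ℕ)
    (h : (r, c) ∈ cells d lam) : r + 1 ≤ L.top (r, c) := by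
  induction r with
  | zero => exact (L.top_mem _ h).1
  | succ r ih =>
    have h1 : (r, c) ∈ cells d lam := by
      rw [hlam.mem_cells_iff] at h ⊢
      omega
    have h2 := ih h1
    have h3 := L.top_col r c h
    omega

lemma top_le_of_le (L : SkewBarredTableau d lam mu) (r c n : ℕ)
    (h : (r, c + n) ∈ cells d lam) : L.top (r, c) ≤ L.top (r, c + n) := by
  induction n with
  | zero => exact le_rfl
  | succ n ih =>
    obtain ⟨h1, h2⟩ := mem_cells.1 h
    exact (ih (mem_cells.2 ⟨h1, by simp only at h2 ⊢; omega⟩)).trans (L.top_row r (c + n) h)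

lemma topCanonical_of_yamanouchi (hlam : IsPartitionVec lam) {L : SkewBarredTableau d lam mu}
    (h : ∀ a ∈ cells d lam, ∀ k : ℕ, 1 ≤ k → L.topCountUpTo a (k + 1) ≤ L.topCountUpTo a k) :
    L.TopCanonical := by
  rintro ⟨r, c⟩
  induction r using Nat.strong_induction_on generalizing c with
  | _ r ih =>
  intro ha
  obtain ⟨hrd, hc⟩ := mem_cells.1 ha
  simp only at hrd hc
  set e := lam ⟨r, hrd⟩ - 1 with he
  have hm : (r, e) ∈ cells d lam := mem_cells.2 ⟨hrd, by simp only; omega⟩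
  have h1 := succ_le_top hlam L r c ha
  have h2 : L.top (r, c) ≤ L.top (r, e) := by
    have := top_le_of_le L r c (e - c)
    rw [show c + (e - c) = e by omega] at this
    exact this hm
  suffices h3 : L.top (r, e) ≤ r + 1 by simp only; omega
  by_contra h3
  obtain ⟨v, hv⟩ : ∃ v, L.top (r, e) = v + 1 := ⟨L.top (r, e) - 1, by omega⟩
  have h4 : 0 < L.topCountUpTo (r, e) (v + 1) :=
    Finset.card_pos.2 ⟨(r, e), Finset.mem_filter.2 ⟨hm, hv, Or.inr rfl⟩⟩
  obtain ⟨⟨r', c'⟩, hb⟩ := Finset.card_pos.1 (h4.trans_le (h _ hm v (by omega)))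
  rw [Finset.mem_filter] at hb
  simp only [youngBefore, Prod.mk.injEq] at hb
  obtain ⟨hb1, hb2, hb3⟩ := hb
  by_cases hr : r' < r
  · have := ih r' hr c' hb1
    simp only at this
    omega
  · obtain ⟨h5, h6⟩ := mem_cells.1 hb1
    have h7 := hlam ⟨r, hrd⟩ ⟨r', h5⟩ (Fin.mk_le_mk.2 (by omega))
    simp only at h6
    have h8 : c' = e ∧ r' = r := by omega
    rw [h8.1, h8.2] at hb2
    omega

lemma TopCanonical.yamanouchi (hlam : IsPartitionVec lam) {L : SkewBarredTableau d lam mu}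
    (h : L.TopCanonical) {a : ℕ × ℕ} {k : ℕ} (hk : 1 ≤ k) :
    L.topCountUpTo a (k + 1) ≤ L.topCountUpTo a k := by
  refine Finset.card_le_card_of_injOn (fun b => (b.1 - 1, b.2)) ?_ ?_
  · rintro ⟨r, c⟩ hb
    simp only [Finset.coe_filter, Set.mem_ofPred_eq, youngBefore, Prod.ext_iff] at hb ⊢
    obtain ⟨h1, h2, h3⟩ := hb
    have h4 := h _ h1
    simp only at h4
    have h5 : (r - 1, c) ∈ cells d lam := by
      rw [hlam.mem_cells_iff] at h1 ⊢
      omega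
    refine ⟨h5, ?_, ?_⟩
    · rw [h _ h5]
      simp only
      omega
    · omega
  · rintro ⟨r, c⟩ hb ⟨r', c'⟩ hb' heq
    simp only [Finset.coe_filter, Set.mem_ofPred_eq] at hb hb'
    have h1 := h _ hb.1
    have h2 := h _ hb'.1
    simp only [Prod.mk.injEq] at h1 h2 heq ⊢
    omega

lemma strictDesc_of_yamanouchi (hlam : IsPartitionVec lam) (hmu : IsPartitionVec mu)
    {L : SkewBarredTableau d lam mu} (htop : L.TopCanonical)
    (h : ∀ a ∈ cells d mu, ¬ L.barred a → ∀ k : ℕ, 1 ≤ k →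
      L.countUpTo a (k + 1) ≤ L.countUpTo a k) (c : ℕ) :
    StrictDesc d (expo (colHeight mu) (addRho lam) c L.toPath) := by
  induction c with
  | zero =>
    rw [expo_zero]
    exact hlam.strictDesc
  | succ c ih =>
    intro v h1 h2
    have h3 := ih v h1 h2
    rw [expo_toPath, expo_toPath] at h3 ⊢
    rw [Finset.sum_range_succ, Finset.sum_range_succ]
    rcases Nat.eq_zero_or_pos (plainCount (colHeight mu c) (L.toPath c) (v + 1)) with h4 | h4
    · omega
    · obtain ⟨r, hr, hrb, hrv⟩ := plainCount_pos h4
      have hrc := hmu.mem_cells_iff.2 hr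
      have hrb' : ¬ L.barred (r, c) := fun hb =>
        hrb (Finset.mem_filter.2 ⟨Finset.mem_range.2 hr, hb⟩)
      have h5 := h _ hrc hrb' v h1
      rw [countUpTo_eq hmu htop (by omega) hrc, countUpTo_eq hmu htop h1 hrc] at h5
      have h6 : plainCount (colHeight mu c) (L.toPath c) (v + 1) ≤ 1 :=
        plainCount_le_one (toPath_fst_mem hmu L c) _ _
      have h7 : 0 < L.partialCount r c (v + 1) :=
        Finset.card_pos.2 ⟨r, Finset.mem_filter.2 ⟨Finset.mem_range.2 hr, ⟨hrb', hrv⟩, le_rfl⟩⟩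
      have h8 := L.partialCount_le r c v
      simp only at h5
      omega

lemma yamanouchi_of_strictDesc (hmu : IsPartitionVec mu)
    {L : SkewBarredTableau d lam mu} (htop : L.TopCanonical) {a : ℕ × ℕ} (ha : a ∈ cells d mu)
    (h : StrictDesc d (expo (colHeight mu) (addRho lam) a.2 L.toPath))
    (h' : StrictDesc d (expo (colHeight mu) (addRho lam) (a.2 + 1) L.toPath)) {k : ℕ} (hk : 1 ≤ k) :
    L.countUpTo a (k + 1) ≤ L.countUpTo a k := by
  obtain ⟨r, c⟩ := a
  simp only at h h'
  rw [countUpTo_eq hmu htop (by omega) ha, countUpTo_eq hmu htop hk ha]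
  simp only
  by_cases hkd : k < d
  · have h1 := h k hk hkd
    have h2 := h' k hk hkd
    rw [expo_toPath, expo_toPath] at h1 h2
    rw [Finset.sum_range_succ, Finset.sum_range_succ] at h2
    have h3 := L.partialCount_le r c (k + 1)
    rcases Nat.eq_zero_or_pos (L.partialCount r c (k + 1)) with h4 | h4
    · omega
    · obtain ⟨s, hs⟩ := Finset.card_pos.1 h4
      simp only [Finset.mem_filter, Finset.mem_range] at hs
      have h5 : L.partialCount r c k = plainCount (colHeight mu c) (L.toPath c) k := by
        rw [plainCount_toPath, partialCount]
        congr 1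
        refine Finset.filter_congr fun t ht => ⟨fun h => h.1, fun h => ⟨h, ?_⟩⟩
        by_contra hlt
        have h6 : L.bot (s, c) < L.bot (t, c) :=
          columns_lt (toPath_fst_mem hmu L c) (show t < s by omega) hs.1
        omega
      omega
  · have hno : ∀ j, plainCount (colHeight mu j) (L.toPath j) (k + 1) = 0 := by
      intro j
      by_contra hne
      obtain ⟨s, hs, _, hsk⟩ := plainCount_pos (Nat.pos_of_ne_zero hne)
      have := (mem_columns.1 (toPath_fst_mem hmu L j)).1 s hs
      omega
    have h1 : vecAt lam (k + 1) = 0 := by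
      rw [vecAt, dif_neg (by omega)]
    have h2 := L.partialCount_le r c (k + 1)
    rw [hno] at h2
    rw [h1, Finset.sum_eq_zero fun j _ => hno j]
    omega

lemma isLR_iff (hlam : IsPartitionVec lam) (hmu : IsPartitionVec mu)
    (L : SkewBarredTableau d lam mu) (nu : Fin d → ℕ) : L.IsLR nu ↔ L.TopCanonical ∧
      (∀ c < Finset.univ.sup mu, Admissible d (colHeight mu) (addRho lam) c L.toPath) ∧
      plainContent lam (colHeight mu) (Finset.univ.sup mu) L.toPath = nu := by
  have hcont : L.TopCanonical → ((∀ i : Fin d, L.content ((i : ℕ) + 1) = nu i) ↔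
      plainContent lam (colHeight mu) (Finset.univ.sup mu) L.toPath = nu) := by
    intro htop
    rw [funext_iff]
    refine forall_congr' fun i => ?_
    rw [content_eq hmu htop (by omega), vecAt_succ, plainContent]
  constructor
  · rintro ⟨⟨h1, h2⟩, h3⟩
    have htop := topCanonical_of_yamanouchi hlam h1
    refine ⟨htop, fun c _ => ⟨fun r hr => ?_, strictDesc_of_yamanouchi hlam hmu htop h2 _⟩,
      (hcont htop).1 h3⟩
    have hm := hmu.mem_cells_iff.2 hr
    cases c with
    | zero => exact (L.bot_mem _ hm).2.trans (Nat.le_succ d)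
    | succ c => exact L.bot_row _ _ hm
  · rintro ⟨htop, h1, h2⟩
    refine ⟨⟨fun a _ k hk => htop.yamanouchi hlam hk, fun a ha _ k hk => ?_⟩, (hcont htop).2 h2⟩
    have hc := lt_sup_of_mem_cells ha
    refine yamanouchi_of_strictDesc hmu htop ha ?_ (h1 _ hc).2 hk
    obtain ⟨r, c⟩ := a
    cases c with
    | zero =>
      rw [expo_zero]
      exact hlam.strictDesc
    | succ c => exact (h1 c (by simp only at hc; omega)).2

lemma cWt_eq (hmu : IsPartitionVec mu) {L : SkewBarredTableau d lam mu} (htop : L.TopCanonical) :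
    L.cWt = ∏ c ∈ Finset.range (Finset.univ.sup mu),
      barWt d (colHeight mu) (addRho lam) c L.toPath := by
  rw [cWt, Finset.prod_filter, hmu.prod_cells]
  refine Finset.prod_congr rfl fun c _ => ?_
  rw [barWt, toPath, Finset.prod_filter]
  refine Finset.prod_congr rfl fun r hr => ?_
  refine if_congr Iff.rfl ?_ rfl
  have hm := hmu.mem_cells_iff.2 (Finset.mem_range.1 hr)
  have hle := (L.bot_mem _ hm).2
  simp only [eIdx, fIdx, countBefore_eq hmu htop hm, expo_toPath]
  congr 2
  push_cast [hle]
  ring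

lemma toPath_injOn (hmu : IsPartitionVec mu) :
    Set.InjOn (toPath (d := d) (lam := lam) (mu := mu)) {L | L.TopCanonical} := by
  intro L hL L' hL' h
  have hbot : L.bot = L'.bot := by
    funext a
    exact congrFun (congrArg Prod.fst (congrFun h a.2)) a.1
  have hbarred : L.barred = L'.barred := by
    funext a
    have h1 := Finset.ext_iff.1 (congrArg Prod.snd (congrFun h a.2)) a.1
    simp only [toPath, Finset.mem_filter, Finset.mem_range, ← hmu.mem_cells_iff] at h1
    exact propext ⟨fun ha => (h1.1 ⟨L.barred_sub a ha, ha⟩).2,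
      fun ha => (h1.2 ⟨L'.barred_sub a ha, ha⟩).2⟩
  have htop : L.top = L'.top := by
    funext a
    by_cases ha : a ∈ cells d lam
    · rw [hL a ha, hL' a ha]
    · rw [L.top_zero a ha, L'.top_zero a ha]
  cases L
  cases L'
  simp only at hbot hbarred htop
  subst hbot hbarred htop
  rfl

lemma exists_toPath_eq (hlam : IsPartitionVec lam) (hmu : IsPartitionVec mu) {g : ℕ → BarredCol}
    (hg : g ∈ barredPaths d (colHeight mu) (Finset.univ.sup mu))
    (hadm : ∀ c < Finset.univ.sup mu, Admissible d (colHeight mu) (addRho lam) c g) :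
    ∃ L : SkewBarredTableau d lam mu, L.TopCanonical ∧ L.toPath = g := by
  obtain ⟨h1, h2⟩ := mem_barredPaths.1 hg
  have hc : ∀ c, g c ∈ barredColumns d (colHeight mu c) := by
    intro c
    by_cases hc : c < Finset.univ.sup mu
    · exact h1 c hc
    · rw [h2 c (by omega), hmu.colHeight_eq_zero (not_lt.1 hc)]
      exact Finset.mem_product.2 ⟨mem_columns.2 ⟨by simp, by simp, by simp⟩, by simp⟩
  have hcol : ∀ c, (g c).1 ∈ columns d (colHeight mu c) := fun c => (Finset.mem_product.1 (hc c)).1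
  have hbar : ∀ c, (g c).2 ⊆ Finset.range (colHeight mu c) := fun c =>
    Finset.mem_powerset.1 (Finset.mem_product.1 (hc c)).2
  refine ⟨⟨fun a => if a ∈ cells d lam then a.1 + 1 else 0, fun a => (g a.2).1 a.1,
    fun a => a.1 ∈ (g a.2).2, fun a ha => ?_, fun a ha => if_neg ha, fun a ha => ?_, fun a ha => ?_,
    fun a ha => ?_, fun r c ha => ?_, fun r c ha => ?_, fun r c ha => ?_, fun r c ha => ?_⟩,
    fun a ha => if_pos ha, ?_⟩
  · obtain ⟨h, _⟩ := mem_cells.1 ha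
    rw [if_pos ha]
    omega
  · exact (mem_columns.1 (hcol a.2)).1 _ (hmu.mem_cells_iff.1 ha)
  · exact (mem_columns.1 (hcol a.2)).2.1 _
      (not_lt.1 (mt (hmu.mem_cells_iff (r := a.1) (c := a.2)).2 ha))
  · exact hmu.mem_cells_iff.2 (Finset.mem_range.1 (hbar _ ha))
  · have h3 : (r, c) ∈ cells d lam := by
      obtain ⟨h, h'⟩ := mem_cells.1 ha
      exact mem_cells.2 ⟨h, (Nat.lt_succ_self c).trans h'⟩
    rw [if_pos ha, if_pos h3]
  · have h3 : (r, c) ∈ cells d lam :=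
      hlam.mem_cells_iff.2 ((Nat.lt_succ_self r).trans (hlam.mem_cells_iff.1 ha))
    rw [if_pos ha, if_pos h3]
    exact Nat.lt_succ_self _
  · exact (hadm (c + 1) (lt_sup_of_mem_cells ha)).1 r (hmu.mem_cells_iff.1 ha)
  · exact (mem_columns.1 (hcol c)).2.2 _ (hmu.mem_cells_iff.1 ha)
  · funext c
    refine Prod.ext rfl (Finset.ext fun r => ?_)
    simp only [toPath, Finset.mem_filter, and_iff_right_iff_imp]
    exact fun h => hbar c h

end SkewBarredTableau

/-- Equivariant Littlewood–Richardson rule (Molev–Kreiman):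
`c_{λ,μ}^ν = Σ_{L ∈ LR_{λ,μ}^ν} c_L`, the sum over equivariant LR skew tableaux of shape
`λ*μ` and unbarred content `ν`. -/
theorem equivariant_LR_rule (d : ℕ) (hd : 1 ≤ d)
    (lam mu nu : Fin d → ℕ)
    (hlam : IsPartitionVec lam) (hmu : IsPartitionVec mu) (hnu : IsPartitionVec nu)
    (c : (Fin d → ℕ) →₀ P d)
    (hsupp : ∀ η ∈ c.support, IsPartitionVec η ∧ c η ∈ ySub d)
    (hexp : fSchur d lam * fSchur d mu = c.sum fun η q => q * fSchur d η) :
    c nu = ∑ᶠ L ∈ {L : SkewBarredTableau d lam mu | L.IsLR nu}, L.cWt := by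
  have hprod : ∀ g, ∏ j ∈ Finset.range (Finset.univ.sup mu),
      stepWt d (colHeight mu) (addRho lam) j g =
      if ∀ j < Finset.univ.sup mu, Admissible d (colHeight mu) (addRho lam) j g then
        ∏ j ∈ Finset.range (Finset.univ.sup mu), barWt d (colHeight mu) (addRho lam) j g
      else 0 := by
    intro g
    split_ifs with h
    · exact Finset.prod_congr rfl fun j hj => if_pos (h j (Finset.mem_range.1 hj))
    · push Not at h
      obtain ⟨j, hj, hj'⟩ := h
      exact Finset.prod_eq_zero (Finset.mem_range.2 hj) (if_neg hj')
  rw [structure_constant_eq_sum hlam hmu c hsupp hexp nu]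
  simp only [hprod]
  rw [← Finset.sum_filter, ← finsum_mem_coe_finset]
  symm
  refine finsum_mem_eq_of_bijOn SkewBarredTableau.toPath ⟨?_, ?_, ?_⟩ ?_
  · intro L hL
    obtain ⟨_, h1, h2⟩ := (SkewBarredTableau.isLR_iff hlam hmu L nu).1 hL
    exact Finset.mem_coe.2 (Finset.mem_filter.2
      ⟨Finset.mem_filter.2 ⟨SkewBarredTableau.toPath_mem hmu L, h2⟩, h1⟩)
  · exact (SkewBarredTableau.toPath_injOn hmu).mono
      fun L hL => ((SkewBarredTableau.isLR_iff hlam hmu L nu).1 hL).1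
  · intro g hg
    obtain ⟨hg, h1⟩ := Finset.mem_filter.1 (Finset.mem_coe.1 hg)
    obtain ⟨hg, h2⟩ := Finset.mem_filter.1 hg
    obtain ⟨L, htop, rfl⟩ := SkewBarredTableau.exists_toPath_eq hlam hmu hg h1
    exact ⟨L, (SkewBarredTableau.isLR_iff hlam hmu L nu).2 ⟨htop, h1, h2⟩, rfl⟩
  · exact fun L hL =>
      SkewBarredTableau.cWt_eq hmu ((SkewBarredTableau.isLR_iff hlam hmu L nu).1 hL).1

end EqLR
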